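/- arXiv:2010.01561 — 2 statements merged into one kernel-verified Lean document; each statement's English description precedes it below -/
import Mathlib

section
/- Let 1 < p < ∞ and λ < p − 1. For every ε > 0 there exist a continuous function r : [0,π_p] → ℝ and a nontrivial solution u of the boundary value problem (|u′|^{p−2}u′)′ + (λ + r(x))|u|^{p−2}u = 0 on (0,π_p), u(0) = u(π_p) = 0, such that ∫₀^{π_p} r_+(x) dx < C(p,λ) + ε. (Hence the Lyapunov-type bound ∫₀^{π_p} r_+ dx > C(p,λ) is sharp.) -/
/-- `arcsin_p x = ∫₀ˣ (1 - tᵖ)^(-1/p) dt`. -/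
noncomputable def arcsinP (p x : ℝ) : ℝ := ∫ t in (0:ℝ)..x, (1 - t ^ p) ^ (-(1 / p))

/-- The generalized π: `π_p = 2 arcsin_p 1`. -/
noncomputable def piP (p : ℝ) : ℝ := 2 * arcsinP p 1

/-- `sin_p` on `[0, π_p/2]`, defined as the inverse of `arcsin_p : [0,1] → [0, π_p/2]`. -/
noncomputable def sinPHalf (p : ℝ) : ℝ → ℝ := Function.invFunOn (arcsinP p) (Set.Icc 0 1)

/-- `sin_p` on `[0, π_p]`, extended by `sin_p x = sin_p (π_p - x)`. -/
noncomputable def sinP (p x : ℝ) : ℝ :=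
  if x ≤ piP p / 2 then sinPHalf p x else sinPHalf p (piP p - x)

/-- `cos_p x = (1 - sin_p x ^ p)^(1/p)` on `[0, π_p/2]`, with minus sign on `[π_p/2, π_p]`. -/
noncomputable def cosP (p x : ℝ) : ℝ :=
  if x ≤ piP p / 2 then (1 - sinP p x ^ p) ^ (1 / p)
  else -((1 - sinP p x ^ p) ^ (1 / p))

/-- `cot_p x = cos_p x / sin_p x`. -/
noncomputable def cotP (p x : ℝ) : ℝ := cosP p x / sinP p x

/-- `arcsinh_p x = ∫₀ˣ (1 + tᵖ)^(-1/p) dt`. -/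
noncomputable def arcsinhP (p x : ℝ) : ℝ := ∫ t in (0:ℝ)..x, (1 + t ^ p) ^ (-(1 / p))

/-- `sinh_p : [0,∞) → [0,∞)`, defined as the inverse of `arcsinh_p` on `[0,∞)`. -/
noncomputable def sinhP (p : ℝ) : ℝ → ℝ := Function.invFunOn (arcsinhP p) (Set.Ici 0)

/-- `cosh_p x = (1 + sinh_p x ^ p)^(1/p)`. -/
noncomputable def coshP (p x : ℝ) : ℝ := (1 + sinhP p x ^ p) ^ (1 / p)

/-- `coth_p x = cosh_p x / sinh_p x`. -/
noncomputable def cothP (p x : ℝ) : ℝ := coshP p x / sinhP p x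

/-- `u` (with continuous derivative `u'` on `[0, π_p]`) is a nontrivial solution of
`(|u'|^(p-2) u')' + (λ + r x) |u|^(p-2) u = 0` on `(0, π_p)` with `u 0 = u π_p = 0`. -/
def IsNontrivialSolution (p lam : ℝ) (r u u' : ℝ → ℝ) : Prop :=
  (∃ x ∈ Set.Icc (0:ℝ) (piP p), u x ≠ 0) ∧
  ContinuousOn u' (Set.Icc 0 (piP p)) ∧
  (∀ x ∈ Set.Icc (0:ℝ) (piP p), HasDerivWithinAt u (u' x) (Set.Icc 0 (piP p)) x) ∧
  u 0 = 0 ∧ u (piP p) = 0 ∧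
  ∀ x ∈ Set.Ioo (0:ℝ) (piP p),
    HasDerivAt (fun y => |u' y| ^ (p - 2) * u' y)
      (-((lam + r x) * |u x| ^ (p - 2) * u x)) x

/-- The sharp Lyapunov constant `C(p, λ)` for `λ < p - 1`. -/
noncomputable def lyapC (p lam : ℝ) : ℝ :=
  if 0 < lam then
    2 * (lam / (p - 1)) ^ ((p - 1) / p) *
      (cotP p (piP p / 2 * (lam / (p - 1)) ^ (1 / p))) ^ (p - 1)
  else if lam = 0 then 2 ^ p / piP p ^ (p - 1)
  else
    2 * (-lam / (p - 1)) ^ ((p - 1) / p) *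
      (cothP p (piP p / 2 * (-lam / (p - 1)) ^ (1 / p))) ^ (p - 1)


lemma glueD {A B : ℝ → ℝ} {h d x : ℝ} (hA : x ≤ h → HasDerivAt A d x)
    (hB : h ≤ x → HasDerivAt B d x) (hAB : A h = B h) :
    HasDerivAt (fun y => if y ≤ h then A y else B y) d x := by
  rcases lt_trichotomy x h with hx | hx | hx
  · refine (hA hx.le).congr_of_eventuallyEq ?_
    filter_upwards [Iio_mem_nhds hx] with y hy
    simp [(Set.mem_Iio.1 hy).le]
  · subst hx
    have h1 : HasDerivWithinAt (fun y => if y ≤ x then A y else B y) d (Set.Iic x) x :=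
      (hA le_rfl).hasDerivWithinAt.congr (fun y hy => by simp [Set.mem_Iic.1 hy]) (by simp)
    have h2 : HasDerivWithinAt (fun y => if y ≤ x then A y else B y) d (Set.Ici x) x := by
      refine (hB le_rfl).hasDerivWithinAt.congr (fun y hy => ?_) (by simp [hAB])
      rcases eq_or_lt_of_le (Set.mem_Ici.1 hy) with h | h
      · subst h; simp [hAB]
      · simp [h]
    have h3 := h1.union h2
    rw [Set.Iic_union_Ici] at h3
    exact hasDerivWithinAt_univ.1 h3
  · refine (hB hx.le).congr_of_eventuallyEq ?_
    filter_upwards [Ioi_mem_nhds hx] with y hy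
    simp [Set.mem_Ioi.1 hy]

lemma phiD (b δ x : ℝ) : HasDerivAt (fun y => 1 - (max ((y - b) / δ) 0) ^ 2)
    (-(2 * max ((x - b) / δ) 0 / δ)) x := by
  have key : ∀ t : ℝ, HasDerivAt (fun y : ℝ => (max y 0) ^ 2) (2 * max t 0) t := by
    intro t
    have := glueD (A := fun _ => (0:ℝ)) (B := fun y => y ^ 2) (h := 0) (d := 2 * max t 0) (x := t)
      (fun h => by simpa [h] using hasDerivAt_const t (0:ℝ))
      (fun h => by simpa [h] using hasDerivAt_pow 2 t) (by simp)
    refine this.congr_of_eventuallyEq (Filter.Eventually.of_forall fun y => ?_)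
    by_cases hy : y ≤ 0
    · simp [hy]
    · simp [hy, (not_le.1 hy).le]
  have h2 := (key ((x - b) / δ)).comp x (((hasDerivAt_id x).sub_const b).div_const δ)
  have h3 := h2.const_sub 1
  refine HasDerivAt.congr_deriv (f := fun y => 1 - (max ((y - b) / δ) 0) ^ 2) h3 ?_
  ring

lemma absrpow {p x : ℝ} (hp : 1 < p) (hx : 0 ≤ x) : |x| ^ (p - 2) * x = x ^ (p - 1) := by
  rcases hx.eq_or_lt with h | h
  · subst h; rw [Real.zero_rpow (by linarith : p - 1 ≠ 0)]; simp
  · rw [abs_of_pos h]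
    nth_rewrite 2 [← Real.rpow_one x]
    rw [← Real.rpow_add h]; ring_nf

lemma chooseDelta (A B c ε h : ℝ) (f g : ℝ → ℝ) (hh : 0 < h) (hB : 0 < B) (hc : 0 ≤ c) (hε : 0 < ε)
    (hf : Continuous f) (hg : Continuous g) (hfh : f h = A) (hgh : g h = B) :
    ∃ δ N n : ℝ, 0 < δ ∧ δ < h ∧ 0 < n ∧ (∀ x ∈ Set.Icc (h - δ) h, f x ≤ N ∧ n ≤ g x) ∧
      2 * (c * (1 + B / n) * δ + N / n) < 2 * (A / B) + ε := by
  have hcont : ContinuousAt (fun η : ℝ => (A + η) / (B - η)) 0 := by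
    apply ContinuousAt.div
    · fun_prop
    · fun_prop
    · simpa using hB.ne'
  have e1 : ∀ᶠ η in nhds (0:ℝ), (A + η) / (B - η) < A / B + ε / 4 :=
    hcont.eventually_lt_const (by simp; linarith)
  have e2 : ∀ᶠ η in nhds (0:ℝ), η < B := Iio_mem_nhds hB
  obtain ⟨η, ⟨h1, h2⟩, h3⟩ := ((e1.and e2).filter_mono nhdsWithin_le_nhds |>.and
    (self_mem_nhdsWithin : Set.Ioi (0:ℝ) ∈ nhdsWithin 0 (Set.Ioi 0))).exists
  have h3 : 0 < η := h3
  have e3 : ∀ᶠ x in nhds h, f x < A + η := hf.continuousAt.eventually_lt_const (by linarith)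
  have e4 : ∀ᶠ x in nhds h, B - η < g x := hg.continuousAt.eventually_const_lt (by linarith)
  obtain ⟨δ0, hδ0, hb⟩ := Metric.eventually_nhds_iff.1 (e3.and e4)
  set K := c * (1 + B / (B - η)) with hK
  have hn : 0 < B - η := by linarith
  have hK0 : 0 ≤ K := by positivity
  refine ⟨min (δ0 / 2) (min (h / 2) (ε / 4 / (K + 1))), A + η, B - η, ?_, ?_, hn, ?_, ?_⟩
  · positivity
  · exact lt_of_le_of_lt ((min_le_right _ _).trans (min_le_left _ _)) (by linarith)
  · intro x hx
    have := min_le_left (δ0 / 2) (min (h / 2) (ε / 4 / (K + 1)))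
    have hd : dist x h < δ0 := by
      rw [Real.dist_eq, abs_lt]; constructor <;> linarith [hx.1, hx.2]
    exact ⟨(hb hd).1.le, (hb hd).2.le⟩
  · have : min (δ0 / 2) (min (h / 2) (ε / 4 / (K + 1))) ≤ ε / 4 / (K + 1) :=
      (min_le_right _ _).trans (min_le_right _ _)
    have h5 : K * min (δ0 / 2) (min (h / 2) (ε / 4 / (K + 1))) ≤ K * (ε / 4 / (K + 1)) :=
      mul_le_mul_of_nonneg_left this hK0
    have h6 : K * (ε / 4 / (K + 1)) ≤ ε / 4 := by
      rw [← mul_div_assoc, div_le_iff₀ (by positivity)]; nlinarith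
    linarith

lemma core (p lam h : ℝ) (hp : 1 < p) (hh : 0 < h) (hpi : piP p = 2 * h) (S D : ℝ → ℝ)
    (hS : ∀ x, HasDerivAt S (D x) x) (hDc : Continuous D) (hD : ∀ x, 0 < D x) (hS0 : S 0 = 0)
    (hDD : ∀ x, 0 < x → x ≤ h →
      HasDerivAt (fun y => D y ^ (p - 1)) (-(lam * S x ^ (p - 1))) x) (ε : ℝ) (hε : 0 < ε) :
    ∃ r u u' : ℝ → ℝ,
      ContinuousOn r (Set.Icc 0 (piP p)) ∧
      IsNontrivialSolution p lam r u u' ∧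
      (∫ x in (0:ℝ)..piP p, max (r x) 0) < 2 * (D h / S h) ^ (p - 1) + ε := by
  have hp1 : 0 < p - 1 := by linarith
  have hSc : Continuous S := continuous_iff_continuousAt.2 fun x => (hS x).continuousAt
  have hSm : StrictMono S := strictMono_of_hasDerivAt_pos hS hD
  have hSpos : ∀ x, 0 < x → 0 < S x := fun x hx => by simpa [hS0] using hSm hx
  have hSh := hSpos h hh
  obtain ⟨δ, N, n, hδ, hδh, hn, hNn, hfin⟩ := chooseDelta (D h ^ (p - 1)) (S h ^ (p - 1)) |lam| ε h
    (fun x => D x ^ (p - 1)) (fun x => S x ^ (p - 1)) hh (by positivity) (abs_nonneg _) hε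
    (hDc.rpow_const fun x => Or.inr hp1.le) (hSc.rpow_const fun x => Or.inr hp1.le) rfl rfl
  set b := h - δ with hb
  have hb0 : 0 < b := by linarith
  have hbh : b < h := by linarith
  set τ : ℝ → ℝ := fun x => max ((x - b) / δ) 0 with hτ
  have hτc : Continuous τ := by fun_prop
  have hτ0 : ∀ x, 0 ≤ τ x := fun x => le_max_right _ _
  have hτ1 : ∀ x ≤ h, τ x ≤ 1 := fun x hx => max_le (by rw [div_le_one hδ]; linarith) zero_le_one
  have hτb : ∀ x ≤ b, τ x = 0 := fun x hx =>
    max_eq_right (div_nonpos_of_nonpos_of_nonneg (by linarith) hδ.le)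
  have hτe : ∀ x, b ≤ x → τ x = (x - b) / δ := fun x hx =>
    max_eq_left (div_nonneg (by linarith) hδ.le)
  have hτh : τ h = 1 := by rw [hτe h hbh.le, div_eq_one_iff_eq hδ.ne']; linarith
  set φ : ℝ → ℝ := fun x => 1 - τ x ^ 2 with hφ
  have hφc : Continuous φ := by fun_prop
  have hφ0 : ∀ x ≤ h, 0 ≤ φ x := fun x hx => by
    have := hτ1 x hx; have := hτ0 x; simp only [hφ]; nlinarith
  have hφ1 : ∀ x, φ x ≤ 1 := fun x => by simp only [hφ]; nlinarith [sq_nonneg (τ x)]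
  have hφh : φ h = 0 := by simp [hφ, hτh]
  have hφb : ∀ x ≤ b, φ x = 1 := fun x hx => by simp [hφ, hτb x hx]
  have hφd : ∀ x, HasDerivAt φ (-(2 * τ x / δ)) x := fun x => phiD b δ x
  set U' : ℝ → ℝ := fun x => D x * (max (φ x) 0) ^ (1 / (p - 1)) with hU'
  have hU'c : Continuous U' := by
    apply hDc.mul
    exact (hφc.max continuous_const).rpow_const fun x => Or.inr (by positivity)
  have hU'0 : ∀ x, 0 ≤ U' x := fun x => mul_nonneg (hD x).le (by positivity)
  have hU'h : U' h = 0 := by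
    simp only [hU', hφh, max_self]; rw [Real.zero_rpow (by positivity)]; simp
  have hU'b : ∀ x ≤ b, U' x = D x := fun x hx => by simp [hU', hφb x hx]
  set U : ℝ → ℝ := fun x => ∫ t in (0:ℝ)..x, U' t with hU
  have hUd : ∀ x, HasDerivAt U (U' x) x := fun x => hU'c.integral_hasStrictDerivAt 0 x |>.hasDerivAt
  have hUc : Continuous U := continuous_iff_continuousAt.2 fun x => (hUd x).continuousAt
  have hUm : Monotone U := monotone_of_hasDerivAt_nonneg hUd hU'0
  have hUb : ∀ x, 0 ≤ x → x ≤ b → U x = S x := by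
    intro x hx0 hx
    have : U x = ∫ t in (0:ℝ)..x, D t := by
      apply intervalIntegral.integral_congr
      intro t ht
      rw [Set.uIcc_of_le hx0] at ht
      exact hU'b t (ht.2.trans hx)
    rw [this, intervalIntegral.integral_eq_sub_of_hasDerivAt (fun t _ => hS t)
      (hDc.intervalIntegrable _ _), hS0, sub_zero]
  have hU0 : U 0 = 0 := by simp [hU]
  have hUSb : ∀ x, b ≤ x → S b ≤ U x := fun x hx => by
    rw [← hUb b hb0.le le_rfl]; exact hUm hx
  have hUpos : ∀ x, 0 < x → 0 < U x := by
    intro x hx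
    rcases le_total x b with h1 | h1
    · rw [hUb x hx.le h1]; exact hSpos x hx
    · exact (hSpos b hb0).trans_le (hUSb x h1)
  -- W
  set W : ℝ → ℝ := fun x => D x ^ (p - 1) * φ x with hW
  set W' : ℝ → ℝ := fun x => -(lam * S x ^ (p - 1)) * φ x + D x ^ (p - 1) * (-(2 * τ x / δ)) with hW'
  have hWd : ∀ x, 0 < x → x ≤ h → HasDerivAt W (W' x) x := fun x h0 h1 =>
    (hDD x h0 h1).mul (hφd x)
  have hWc' : Continuous W' := by
    have h1 : Continuous fun x => S x ^ (p - 1) := hSc.rpow_const fun x => Or.inr hp1.le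
    have h2 : Continuous fun x => D x ^ (p - 1) := hDc.rpow_const fun x => Or.inr hp1.le
    fun_prop
  have hWU : ∀ x ≤ h, U' x ^ (p - 1) = W x := by
    intro x hx
    simp only [hU', hW]
    rw [Real.mul_rpow (hD x).le (by positivity), ← Real.rpow_mul (by positivity),
      one_div_mul_cancel hp1.ne', Real.rpow_one, max_eq_left (hφ0 x hx)]
  set M : ℝ → ℝ := fun x => min x (2 * h - x) with hM
  have hMc : Continuous M := by fun_prop
  set ρ : ℝ → ℝ := fun x => -lam - W' (max x b) / U (max x b) ^ (p - 1) with hρ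
  have hρc : Continuous ρ := by
    have h1 : Continuous fun x : ℝ => max x b := by fun_prop
    apply continuous_const.sub
    apply (hWc'.comp h1).div
    · exact (hUc.comp h1).rpow_const fun x => Or.inr hp1.le
    · intro x
      exact (Real.rpow_pos_of_pos (hUpos _ (lt_max_of_lt_right hb0)) _).ne'
  have hρb : ∀ x ≤ b, ρ x = 0 := by
    intro x hx
    have hs := Real.rpow_pos_of_pos (hSpos b hb0) (p - 1)
    simp only [hρ, hW', max_eq_right hx, hφb b le_rfl, hτb b le_rfl, hUb b hb0.le le_rfl]
    field_simp
    ring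
  have hρW : ∀ x, 0 < x → W' x = -((lam + ρ x) * U x ^ (p - 1)) := by
    intro x hx
    rcases le_total x b with h1 | h1
    · rw [hρb x h1, hUb x hx.le h1]
      simp [hW', hφb x h1, hτb x h1]
    · have := Real.rpow_pos_of_pos (hUpos x hx) (p - 1)
      simp only [hρ, max_eq_left h1]
      field_simp
      ring
  refine ⟨fun x => ρ (M x), fun x => if x ≤ h then U x else U (2 * h - x),
    fun x => if x ≤ h then U' x else -U' (2 * h - x), (hρc.comp hMc).continuousOn, ⟨?_, ?_, ?_, ?_, ?_, ?_⟩, ?_⟩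
  · exact ⟨h, ⟨hh.le, by linarith⟩, by simpa using (hUpos h hh).ne'⟩
  · apply Continuous.continuousOn
    apply Continuous.if_le hU'c (by fun_prop) continuous_id continuous_const
    intro x hx
    simp only [id] at hx
    subst hx
    rw [show 2 * x - x = x by ring, hU'h, neg_zero]
  · intro x _
    apply HasDerivAt.hasDerivWithinAt
    apply glueD (A := U) (B := fun x => U (2 * h - x))
    · intro hx; simpa [hx] using hUd x
    · intro hx
      have e := (hUd (2 * h - x)).comp x ((hasDerivAt_id x).const_sub (2 * h))
      refine HasDerivAt.congr_deriv (f := fun x => U (2 * h - x)) e ?_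
      rcases hx.eq_or_lt with h1 | h1
      · subst h1; simp only [le_refl, if_true]; rw [show 2 * h - h = h by ring, hU'h]; simp
      · simp only [not_le.2 h1, if_false]; ring
    · congr 1; ring
  · simp [hh.le, hU0]
  · simp [hpi, hU0, hh]
  · intro x hx
    rw [hpi] at hx
    have e1 : (fun y => |if y ≤ h then U' y else -U' (2 * h - y)| ^ (p - 2) *
        (if y ≤ h then U' y else -U' (2 * h - y))) =
        fun y => if y ≤ h then W y else -W (2 * h - y) := by
      funext y
      by_cases hy : y ≤ h
      · simp only [hy, if_true]
        rw [absrpow hp (hU'0 y), hWU y hy]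
      · simp only [hy, if_false]
        rw [abs_neg, mul_neg, absrpow hp (hU'0 _), hWU _ (by linarith [not_le.1 hy])]
    simp only [e1]
    have eM : (if x ≤ h then U x else U (2 * h - x)) = U (M x) := by
      by_cases hy : x ≤ h
      · simp only [hy, if_true, hM]; rw [min_eq_left (by linarith)]
      · simp only [hy, if_false, hM]; rw [min_eq_right (by linarith [not_le.1 hy])]
    have hM0 : 0 < M x := lt_min hx.1 (by linarith [hx.2])
    rw [eM, mul_assoc, absrpow hp (hUpos _ hM0).le, ← hρW _ hM0]
    apply glueD (A := W) (B := fun y => -W (2 * h - y))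
    · intro hy
      have : M x = x := min_eq_left (by linarith)
      rw [this]; exact hWd x hx.1 hy
    · intro hy
      have : M x = 2 * h - x := min_eq_right (by linarith)
      rw [this]
      have e := ((hWd (2 * h - x) (by linarith [hx.2]) (by linarith)).comp x
        ((hasDerivAt_id x).const_sub (2 * h))).neg
      refine HasDerivAt.congr_deriv (f := fun y => -W (2 * h - y)) e ?_
      ring
    · simp [hW, show 2 * h - h = h by ring, hφh]
  · rw [hpi]
    have hmc : Continuous fun x => max (ρ x) 0 := by fun_prop
    have hmMc : Continuous fun x => max (ρ (M x)) 0 := hmc.comp hMc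
    have i1 : ∫ x in (0:ℝ)..(2 * h), max (ρ (M x)) 0 = 2 * ∫ x in (0:ℝ)..h, max (ρ x) 0 := by
      rw [← intervalIntegral.integral_add_adjacent_intervals (b := h)
        (hmMc.intervalIntegrable _ _) (hmMc.intervalIntegrable _ _)]
      have j1 : ∫ x in (0:ℝ)..h, max (ρ (M x)) 0 = ∫ x in (0:ℝ)..h, max (ρ x) 0 := by
        apply intervalIntegral.integral_congr
        intro x hx
        rw [Set.uIcc_of_le hh.le] at hx
        have : M x = x := min_eq_left (by linarith [hx.2])
        simp only [this]
      have j2 : ∫ x in h..(2 * h), max (ρ (M x)) 0 = ∫ x in h..(2 * h), max (ρ (2 * h - x)) 0 := by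
        apply intervalIntegral.integral_congr
        intro x hx
        rw [Set.uIcc_of_le (by linarith)] at hx
        have : M x = 2 * h - x := min_eq_right (by linarith [hx.1])
        simp only [this]
      rw [j1, j2, intervalIntegral.integral_comp_sub_left (fun x => max (ρ x) 0) (2 * h)]
      rw [show 2 * h - 2 * h = 0 by ring, show 2 * h - h = h by ring]
      ring
    have i2 : ∫ x in (0:ℝ)..h, max (ρ x) 0 = ∫ x in b..h, max (ρ x) 0 := by
      rw [← intervalIntegral.integral_add_adjacent_intervals (b := b)
        (hmc.intervalIntegrable _ _) (hmc.intervalIntegrable _ _)]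
      have : ∫ x in (0:ℝ)..b, max (ρ x) 0 = ∫ x in (0:ℝ)..b, (0:ℝ) := by
        apply intervalIntegral.integral_congr
        intro x hx
        rw [Set.uIcc_of_le hb0.le] at hx
        simp [hρb x hx.2]
      rw [this]; simp
    set K := |lam| * (1 + S h ^ (p - 1) / n) with hK
    have hK0 : 0 ≤ K := by positivity
    have hN0 : 0 ≤ N := le_trans (Real.rpow_nonneg (hD h).le _) (hNn h ⟨hbh.le, le_rfl⟩).1
    have i3 : ∫ x in b..h, max (ρ x) 0 ≤ ∫ x in b..h, (K + N / n * (2 * τ x / δ)) := by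
      apply intervalIntegral.integral_mono_on hbh.le (hmc.intervalIntegrable _ _)
      · apply Continuous.intervalIntegrable; fun_prop
      · intro x hx
        have hτx := hτ0 x
        apply max_le _ (by positivity)
        have hu := Real.rpow_pos_of_pos (hUpos x (hb0.trans_le hx.1)) (p - 1)
        have hnu : n ≤ U x ^ (p - 1) := (hNn b ⟨le_rfl, hbh.le⟩).2.trans
          (Real.rpow_le_rpow (hSpos b hb0).le (hUSb x hx.1) hp1.le)
        have e : ρ x = -lam + lam * (S x ^ (p - 1) / U x ^ (p - 1) * φ x)
            + D x ^ (p - 1) / U x ^ (p - 1) * (2 * τ x / δ) := by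
          simp only [hρ, hW', max_eq_left hx.1]; field_simp; ring
        rw [e]
        have hs0 : 0 ≤ S x ^ (p - 1) := Real.rpow_nonneg (hSpos x (hb0.trans_le hx.1)).le _
        have a1 : S x ^ (p - 1) / U x ^ (p - 1) ≤ S h ^ (p - 1) / n :=
          div_le_div₀ (by positivity) (Real.rpow_le_rpow (hSpos x (hb0.trans_le hx.1)).le
            (hSm.monotone hx.2) hp1.le) hn hnu
        have a2 : D x ^ (p - 1) / U x ^ (p - 1) ≤ N / n := div_le_div₀ hN0 (hNn x hx).1 hn hnu
        have a3 : S x ^ (p - 1) / U x ^ (p - 1) * φ x ≤ S h ^ (p - 1) / n := 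
          (mul_le_of_le_one_right (by positivity) (hφ1 x)).trans a1
        have a4 : 0 ≤ S x ^ (p - 1) / U x ^ (p - 1) * φ x := mul_nonneg (by positivity) (hφ0 x hx.2)
        have a5 : lam * (S x ^ (p - 1) / U x ^ (p - 1) * φ x) ≤ |lam| * (S h ^ (p - 1) / n) :=
          mul_le_mul (le_abs_self _) a3 a4 (abs_nonneg _)
        have a6 : D x ^ (p - 1) / U x ^ (p - 1) * (2 * τ x / δ) ≤ N / n * (2 * τ x / δ) :=
          mul_le_mul_of_nonneg_right a2 (by positivity)
        have := neg_le_abs lam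
        simp only [hK]
        linarith
    have i4 : ∫ x in b..h, (K + N / n * (2 * τ x / δ)) = K * δ + N / n := by
      have := intervalIntegral.integral_eq_sub_of_hasDerivAt (a := b) (b := h)
        (f := fun x => K * x - N / n * φ x) (f' := fun x => K + N / n * (2 * τ x / δ))
        (fun x _ => by
          have := ((hasDerivAt_id x).const_mul K).sub ((hφd x).const_mul (N / n))
          refine HasDerivAt.congr_deriv (f := fun x => K * x - N / n * φ x) this ?_
          ring) (by apply Continuous.intervalIntegrable; fun_prop)
      rw [this, hφh, hφb b le_rfl]; rw [hb]; ring
    rw [Real.div_rpow (hD h).le hSh.le]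
    show ∫ x in (0:ℝ)..(2 * h), max (ρ (M x)) 0 < _
    rw [i1, i2]
    linarith

lemma invLemma (G : ℝ → ℝ) (c : ℝ) (hc : 0 < c) (hG : Continuous G) (hcG : ∀ x, c ≤ G x) :
    ∃ S : ℝ → ℝ, (∀ x, HasDerivAt S (G (S x))⁻¹ x) ∧ ∀ y, S (∫ t in (0:ℝ)..y, G t) = y := by
  set F : ℝ → ℝ := fun y => ∫ t in (0:ℝ)..y, G t with hF
  have hFd : ∀ x, HasDerivAt F (G x) x := fun x => (hG.integral_hasStrictDerivAt 0 x).hasDerivAt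
  have hFm : StrictMono F := strictMono_of_hasDerivAt_pos hFd fun x => hc.trans_le (hcG x)
  have hFc : Continuous F := continuous_iff_continuousAt.2 fun x => (hFd x).continuousAt
  have hF0 : F 0 = 0 := by simp [hF]
  have hm : Monotone fun x => F x - c * x := by
    refine monotone_of_hasDerivAt_nonneg (f' := fun x => G x - c * 1)
      (fun x => (hFd x).sub ((hasDerivAt_id x).const_mul c)) fun x => ?_
    have := hcG x
    simp only [Pi.zero_apply]; linarith
  have t1 : Filter.Tendsto F Filter.atTop Filter.atTop := by
    refine Filter.tendsto_atTop_mono' _ ?_ (Filter.tendsto_id.const_mul_atTop hc)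
    filter_upwards [Filter.eventually_ge_atTop 0] with x hx
    have := hm hx
    simp [hF0] at this
    simpa using this
  have t2 : Filter.Tendsto F Filter.atBot Filter.atBot := by
    refine Filter.tendsto_atBot_mono' _ ?_ (Filter.tendsto_id.const_mul_atBot hc)
    filter_upwards [Filter.eventually_le_atBot 0] with x hx
    have := hm hx
    simp [hF0] at this
    simpa using this
  have hs := hFc.surjective t1 t2
  let e := StrictMono.orderIsoOfSurjective F hFm hs
  have he : ∀ x, e x = F x := fun x => rfl
  refine ⟨e.symm, fun x => ?_, fun y => ?_⟩
  · refine HasDerivAt.of_local_left_inverse (f := F) e.symm.continuous.continuousAt (hFd _)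
      (hc.trans_le (hcG _)).ne' (Filter.Eventually.of_forall fun y => ?_)
    rw [← he]; simp
  · exact e.symm_apply_apply y

lemma build (p lam σ a h : ℝ) (hp : 1 < p) (hl : lam = (p - 1) * σ) (ha : 0 < a)
    (hσ : 0 < 1 - σ * a ^ p) (hh : ∫ t in (0:ℝ)..a, (1 - σ * t ^ p) ^ (-(1 / p)) = h) :
    0 < h ∧ ∃ S D : ℝ → ℝ, (∀ x, HasDerivAt S (D x) x) ∧ Continuous D ∧ (∀ x, 0 < D x) ∧ S 0 = 0 ∧
      (∀ x, 0 < x → x ≤ h → HasDerivAt (fun y => D y ^ (p - 1)) (-(lam * S x ^ (p - 1))) x) ∧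
      S h = a ∧ D h = (1 - σ * a ^ p) ^ (1 / p) := by
  have hp0 : 0 < p := by linarith
  obtain ⟨b, hab, hb⟩ : ∃ b, a < b ∧ 0 < 1 - σ * b ^ p := by
    have hcont : ContinuousAt (fun b : ℝ => 1 - σ * b ^ p) a := by
      have := Real.continuousAt_rpow_const a p (Or.inr hp0.le)
      fun_prop
    have e1 : ∀ᶠ b in nhds a, 0 < 1 - σ * b ^ p := hcont.eventually_const_lt hσ
    obtain ⟨b, h1, h2⟩ := ((e1.filter_mono nhdsWithin_le_nhds).and
      (self_mem_nhdsWithin : Set.Ioi a ∈ nhdsWithin a (Set.Ioi a))).exists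
    exact ⟨b, h2, h1⟩
  have hb0 : 0 < b := ha.trans hab
  set cl : ℝ → ℝ := fun t => max 0 (min t b) with hcl
  have cl0 : ∀ t, 0 ≤ cl t := fun t => le_max_left _ _
  have clb : ∀ t, cl t ≤ b := fun t => max_le hb0.le (min_le_right _ _)
  have cle : ∀ t, 0 ≤ t → t ≤ b → cl t = t := fun t h1 h2 => by simp [hcl, h1, h2]
  set E : ℝ → ℝ := fun t => 1 - σ * cl t ^ p with hE
  have hEc : Continuous E := by
    have h1 : Continuous cl := by fun_prop
    have : Continuous fun t => cl t ^ p := h1.rpow_const fun x => Or.inr hp0.le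
    fun_prop
  have hpw : ∀ t, 0 ≤ cl t ^ p ∧ cl t ^ p ≤ b ^ p := fun t =>
    ⟨Real.rpow_nonneg (cl0 t) _, Real.rpow_le_rpow (cl0 t) (clb t) hp0.le⟩
  have hE0 : ∀ t, 0 < E t := by
    intro t
    obtain ⟨h1, h2⟩ := hpw t
    simp only [hE]
    rcases le_total σ 0 with h3 | h3
    · nlinarith
    · nlinarith
  have hEM : ∀ t, E t ≤ 1 + |σ| * b ^ p := by
    intro t
    obtain ⟨h1, h2⟩ := hpw t
    simp only [hE]
    have := neg_le_abs σ
    have : -σ * cl t ^ p ≤ |σ| * b ^ p := mul_le_mul this h2 h1 (abs_nonneg _)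
    linarith
  have hM0 : 0 < 1 + |σ| * b ^ p := by positivity
  have hneg : -(1 / p) ≤ 0 := by simp; positivity
  obtain ⟨S, hS, hSF⟩ := invLemma (fun t => E t ^ (-(1 / p))) ((1 + |σ| * b ^ p) ^ (-(1 / p)))
    (by positivity) (hEc.rpow_const fun x => Or.inl (hE0 x).ne')
    (fun x => Real.rpow_le_rpow_of_nonpos (hE0 x) (hEM x) hneg)
  have hSd : ∀ x, HasDerivAt S (E (S x) ^ (1 / p)) x := by
    intro x
    have := hS x
    rwa [Real.rpow_neg (hE0 _).le, inv_inv] at this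
  have hDp : ∀ x, 0 < E (S x) ^ (1 / p) := fun x => Real.rpow_pos_of_pos (hE0 _) _
  have hSm : StrictMono S := strictMono_of_hasDerivAt_pos hSd hDp
  have hSc : Continuous S := continuous_iff_continuousAt.2 fun x => (hSd x).continuousAt
  have hS0 : S 0 = 0 := by simpa using hSF 0
  have hSh : S h = a := by
    have := hSF a
    rw [← hh]
    convert this using 2
    apply intervalIntegral.integral_congr
    intro t ht
    rw [Set.uIcc_of_le ha.le] at ht
    simp only [hE, cle t ht.1 (ht.2.trans hab.le)]
  have hpos : 0 < h := by
    rw [← hSm.lt_iff_lt, hS0, hSh]; exact ha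
  refine ⟨hpos, S, fun x => E (S x) ^ (1 / p), hSd,
    (hEc.comp hSc).rpow_const fun x => Or.inr (by positivity), hDp, hS0, ?_, hSh, ?_⟩
  · intro x hx0 hxh
    have s0 : 0 < S x := by rw [← hS0]; exact hSm hx0
    have sb : S x < b := lt_of_le_of_lt (by rw [← hSh]; exact hSm.monotone hxh) hab
    have hEx : E (S x) = 1 - σ * S x ^ p := by simp only [hE, cle _ s0.le sb.le]
    have hE0x := hE0 (S x)
    have d1 : HasDerivAt (fun y => 1 - σ * S y ^ p)
        (-(σ * (E (S x) ^ (1 / p) * p * S x ^ (p - 1)))) x :=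
      (((hSd x).rpow_const (Or.inl s0.ne')).const_mul σ).const_sub 1
    have d2 := d1.rpow_const (p := 1 / p * (p - 1)) (Or.inl (hEx ▸ hE0x.ne'))
    rw [← hEx] at d2
    have ev : (fun y => (E (S y) ^ (1 / p)) ^ (p - 1)) =ᶠ[nhds x]
        fun y => (1 - σ * S y ^ p) ^ (1 / p * (p - 1)) := by
      filter_upwards [hSc.continuousAt.eventually_const_lt s0,
        hSc.continuousAt.eventually_lt_const sb] with y h1 h2
      rw [← Real.rpow_mul (hE0 _).le]
      simp only [hE, cle _ h1.le h2.le]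
    refine (d2.congr_of_eventuallyEq ev).congr_deriv ?_
    have e1 : 1 / p * (p - 1) - 1 = -(1 / p) := by field_simp; ring
    rw [e1, Real.rpow_neg hE0x.le, hl]
    have := hDp x
    field_simp
  · show E (S h) ^ (1 / p) = _
    rw [hSh]; simp only [hE, cle a ha.le hab.le]

lemma scaleInt (p e k y : ℝ) (hk : 0 < k) (hy : 0 < y) :
    ∫ t in (0:ℝ)..(y / k), (1 - e * k ^ p * t ^ p) ^ (-(1 / p)) =
      k⁻¹ * ∫ t in (0:ℝ)..y, (1 - e * t ^ p) ^ (-(1 / p)) := by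
  have h1 := intervalIntegral.integral_comp_mul_left (a := 0) (b := y / k)
    (fun t : ℝ => (1 - e * t ^ p) ^ (-(1 / p))) hk.ne'
  rw [mul_zero, mul_div_cancel₀ _ hk.ne', smul_eq_mul] at h1
  rw [← h1]
  apply intervalIntegral.integral_congr
  intro t ht
  rw [Set.uIcc_of_le (by positivity)] at ht
  simp only
  rw [Real.mul_rpow hk.le ht.1, mul_assoc]

lemma final (p lam e k y : ℝ) (hp : 1 < p) (hk : 0 < k) (hl : lam = (p - 1) * (e * k ^ p))
    (hy : 0 < y) (he : 0 < 1 - e * y ^ p)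
    (hi : ∫ t in (0:ℝ)..y, (1 - e * t ^ p) ^ (-(1 / p)) = k * (piP p / 2)) (ε : ℝ) (hε : 0 < ε) :
    ∃ r u u' : ℝ → ℝ,
      ContinuousOn r (Set.Icc 0 (piP p)) ∧
      IsNontrivialSolution p lam r u u' ∧
      (∫ x in (0:ℝ)..piP p, max (r x) 0) <
        2 * k ^ (p - 1) * ((1 - e * y ^ p) ^ (1 / p) / y) ^ (p - 1) + ε := by
  have e1 : e * k ^ p * (y / k) ^ p = e * y ^ p := by
    rw [mul_assoc, ← Real.mul_rpow hk.le (by positivity), mul_div_cancel₀ _ hk.ne']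
  obtain ⟨hh, S, D, hS, hDc, hD, hS0, hDD, hSh, hDh⟩ := build p lam (e * k ^ p) (y / k) (piP p / 2)
    hp hl (by positivity) (by rwa [e1])
    (by rw [scaleInt p e k y hk hy, hi, inv_mul_cancel_left₀ hk.ne'])
  have := core p lam (piP p / 2) hp hh (by ring) S D hS hDc hD hS0 hDD ε hε
  rw [hSh, hDh, e1] at this
  have e2 : (1 - e * y ^ p) ^ (1 / p) / (y / k) = k * ((1 - e * y ^ p) ^ (1 / p) / y) := by
    field_simp
  rwa [e2, Real.mul_rpow hk.le (by positivity), ← mul_assoc] at this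

lemma arcsin_int (p : ℝ) (hp : 1 < p) : IntervalIntegrable
    (fun t : ℝ => (1 - t ^ p) ^ (-(1 / p))) MeasureTheory.volume 0 1 := by
  have h1 : IntervalIntegrable (fun t : ℝ => t ^ (-(1 / p))) MeasureTheory.volume 0 1 := by
    apply intervalIntegral.intervalIntegrable_rpow'
    rw [neg_lt_neg_iff, div_lt_one (by linarith)]; exact hp
  have h2 := (h1.comp_sub_left 1).symm
  simp only [sub_zero, sub_self] at h2
  refine h2.mono_fun (by apply Measurable.aestronglyMeasurable; fun_prop) ?_
  rw [Set.uIoc_of_le zero_le_one]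
  refine (MeasureTheory.ae_restrict_iff' measurableSet_Ioc).2 (Filter.Eventually.of_forall ?_)
  intro t ht
  rcases ht.2.eq_or_lt with h | h
  · subst h; simp
  · have ht1 : t ^ p ≤ t := by
      have := Real.rpow_le_rpow_of_exponent_ge ht.1 ht.2 hp.le
      rwa [Real.rpow_one] at this
    have h3 : 0 < 1 - t := by linarith
    have h4 : 0 < 1 - t ^ p := by linarith
    beta_reduce
    rw [Real.norm_of_nonneg (by positivity), Real.norm_of_nonneg (by positivity)]
    apply Real.rpow_le_rpow_of_nonpos h3 (by linarith)
    have : 0 < p := by linarith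
    simp; positivity

lemma arcsin_one_pos (p : ℝ) (hp : 1 < p) : 0 < arcsinP p 1 := by
  apply intervalIntegral.intervalIntegral_pos_of_pos_on (arcsin_int p hp) _ zero_lt_one
  intro t ht
  have : t ^ p < 1 := Real.rpow_lt_one ht.1.le ht.2 (by linarith)
  have : 0 < 1 - t ^ p := by linarith
  positivity

lemma piP_pos (p : ℝ) (hp : 1 < p) : 0 < piP p := by
  have := arcsin_one_pos p hp
  unfold piP; linarith

lemma sinPHalf_spec (p z : ℝ) (hp : 1 < p) (hz : 0 < z) (hz1 : z < piP p / 2) :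
    0 < sinPHalf p z ∧ sinPHalf p z < 1 ∧ arcsinP p (sinPHalf p z) = z := by
  have hpi : arcsinP p 1 = piP p / 2 := by unfold piP; ring
  have hc : ContinuousOn (arcsinP p) (Set.Icc 0 1) := by
    have := intervalIntegral.continuousOn_primitive_interval (μ := MeasureTheory.volume)
      (f := fun t : ℝ => (1 - t ^ p) ^ (-(1 / p))) (a := 0) (b := 1)
      (((intervalIntegrable_iff' (by simp)).1 (arcsin_int p hp)))
    rwa [Set.uIcc_of_le zero_le_one] at this
  have h0 : arcsinP p 0 = 0 := by simp [arcsinP]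
  have hex : z ∈ arcsinP p '' Set.Icc 0 1 :=
    intermediate_value_Icc zero_le_one hc ⟨by rw [h0]; exact hz.le, by rw [hpi]; exact hz1.le⟩
  have hm : sinPHalf p z ∈ Set.Icc (0:ℝ) 1 := Function.invFunOn_mem hex
  have he : arcsinP p (sinPHalf p z) = z := Function.invFunOn_eq hex
  refine ⟨lt_of_le_of_ne hm.1 ?_, lt_of_le_of_ne hm.2 ?_, he⟩
  · intro h; rw [← h, h0] at he; exact hz.ne he
  · intro h; rw [h, hpi] at he; exact hz1.ne' he

lemma sinhP_spec (p z : ℝ) (hp : 1 < p) (hz : 0 < z) :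
    0 < sinhP p z ∧ arcsinhP p (sinhP p z) = z := by
  have hp0 : 0 < p := by linarith
  have hneg : -(1 / p) ≤ 0 := by simp; positivity
  have gc : ContinuousOn (fun t : ℝ => (1 + t ^ p) ^ (-(1 / p))) (Set.Ici 0) := by
    have h1 : Continuous fun t : ℝ => 1 + t ^ p :=
      continuous_const.add (Real.continuous_rpow_const hp0.le)
    refine h1.continuousOn.rpow_const fun t ht => Or.inl ?_
    have := Real.rpow_nonneg (Set.mem_Ici.1 ht) p
    positivity
  have hint : ∀ x, 0 ≤ x → IntervalIntegrable (fun t : ℝ => (1 + t ^ p) ^ (-(1 / p)))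
      MeasureTheory.volume 0 x := by
    intro x hx
    apply ContinuousOn.intervalIntegrable
    rw [Set.uIcc_of_le hx]
    exact gc.mono Set.Icc_subset_Ici_self
  have h0 : arcsinhP p 0 = 0 := by simp [arcsinhP]
  set X := Real.exp z - 1 with hX
  have hX0 : 0 ≤ X := by have := Real.add_one_le_exp z; linarith
  have hlow : z ≤ arcsinhP p X := by
    have e1 : ∫ t in (0:ℝ)..X, (1 + t)⁻¹ = z := by
      rw [intervalIntegral.integral_eq_sub_of_hasDerivAt (f := fun t => Real.log (1 + t))]
      · simp [hX]
      · intro t ht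
        rw [Set.uIcc_of_le hX0] at ht
        have := ((hasDerivAt_id t).const_add 1).log (by have := ht.1; simp; linarith)
        simpa using this
      · apply ContinuousOn.intervalIntegrable
        rw [Set.uIcc_of_le hX0]
        apply ContinuousOn.inv₀ (by fun_prop)
        intro t ht; have := ht.1; linarith
    rw [← e1]
    apply intervalIntegral.integral_mono_on hX0 _ (hint X hX0)
    · intro t ht
      have ht0 := ht.1
      have h1 : 1 + t ^ p ≤ (1 + t) ^ p := by
        have := Real.add_rpow_le_rpow_add (zero_le_one) ht0 hp.le
        simpa using this
      have h2 : 0 < 1 + t ^ p := by have := Real.rpow_nonneg ht0 p; linarith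
      have h3 : (1 + t)⁻¹ = ((1 + t) ^ p) ^ (-(1 / p)) := by
        rw [← Real.rpow_mul (by linarith), show p * -(1 / p) = -1 by field_simp, Real.rpow_neg_one]
      rw [h3]
      exact Real.rpow_le_rpow_of_nonpos h2 h1 hneg
    · apply ContinuousOn.intervalIntegrable
      rw [Set.uIcc_of_le hX0]
      apply ContinuousOn.inv₀ (by fun_prop)
      intro t ht; have := ht.1; linarith
  have hc : ContinuousOn (arcsinhP p) (Set.Icc 0 X) := by
    have := intervalIntegral.continuousOn_primitive_interval (μ := MeasureTheory.volume)
      (f := fun t : ℝ => (1 + t ^ p) ^ (-(1 / p))) (a := 0) (b := X)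
      (((intervalIntegrable_iff' (by simp)).1 (hint X hX0)))
    rwa [Set.uIcc_of_le hX0] at this
  have hex : z ∈ arcsinhP p '' Set.Ici 0 :=
    Set.image_mono Set.Icc_subset_Ici_self
      (intermediate_value_Icc hX0 hc ⟨by rw [h0]; exact hz.le, hlow⟩)
  have hm : sinhP p z ∈ Set.Ici (0:ℝ) := Function.invFunOn_mem hex
  have he : arcsinhP p (sinhP p z) = z := Function.invFunOn_eq hex
  refine ⟨lt_of_le_of_ne hm ?_, he⟩
  intro h; rw [← h, h0] at he; exact hz.ne he

/-- Sharpness of the Lyapunov-type inequality: for every `ε > 0` there are a continuous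
`r` and a nontrivial solution of the BVP with `∫₀^{π_p} r₊ < C(p,λ) + ε`. -/
theorem lyapunov_sharp (p lam : ℝ) (hp : 1 < p) (hlam : lam < p - 1) :
    ∀ ε > 0, ∃ r u u' : ℝ → ℝ,
      ContinuousOn r (Set.Icc 0 (piP p)) ∧
      IsNontrivialSolution p lam r u u' ∧
      (∫ x in (0:ℝ)..piP p, max (r x) 0) < lyapC p lam + ε := by
  intro ε hε
  have hp0 : 0 < p := by linarith
  have hp1 : 0 < p - 1 := by linarith
  have hpi := piP_pos p hp
  have kpow : ∀ σ : ℝ, 0 < σ → (σ ^ (1 / p)) ^ p = σ := fun σ hσ => by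
    rw [← Real.rpow_mul hσ.le, one_div_mul_cancel hp0.ne', Real.rpow_one]
  have kpow1 : ∀ σ : ℝ, 0 < σ → (σ ^ (1 / p)) ^ (p - 1) = σ ^ ((p - 1) / p) := fun σ hσ => by
    rw [← Real.rpow_mul hσ.le]; congr 1; ring
  rcases lt_trichotomy lam 0 with h | h | h
  · have hσ : 0 < -lam / (p - 1) := div_pos (by linarith) hp1
    have hk := Real.rpow_pos_of_pos hσ (1 / p)
    obtain ⟨hy, hey⟩ := sinhP_spec p (piP p / 2 * (-lam / (p - 1)) ^ (1 / p)) hp (by positivity)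
    have hyp := Real.rpow_nonneg hy.le p
    have := final p lam (-1) _ _ hp hk (by rw [kpow _ hσ]; field_simp) hy (by linarith)
      (by refine Eq.trans ?_ (hey.trans (mul_comm _ _)); simp only [arcsinhP, neg_one_mul, sub_neg_eq_add]) ε hε
    rw [kpow1 _ hσ] at this
    simpa only [lyapC, not_lt.2 h.le, h.ne, if_false, cothP, coshP, neg_one_mul,
      sub_neg_eq_add] using this
  · have := final p lam 0 1 (piP p / 2) hp one_pos (by simp [h]) (by positivity) (by simp)
      (by simp) ε hε
    have e : lyapC p lam = 2 * 1 ^ (p - 1) *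
        ((1 - 0 * (piP p / 2) ^ p) ^ (1 / p) / (piP p / 2)) ^ (p - 1) := by
      simp only [lyapC, h, lt_irrefl, if_false, if_true, zero_mul, sub_zero, Real.one_rpow, mul_one]
      rw [show 1 / (piP p / 2) = 2 / piP p by rw [one_div_div], Real.div_rpow (by norm_num) hpi.le,
        Real.rpow_sub_one (two_ne_zero) p]
      ring
    rwa [e]
  · have hσ : 0 < lam / (p - 1) := div_pos h hp1
    have hσ1 : lam / (p - 1) < 1 := (div_lt_one hp1).2 hlam
    have hk := Real.rpow_pos_of_pos hσ (1 / p)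
    have hk1 : (lam / (p - 1)) ^ (1 / p) < 1 := Real.rpow_lt_one hσ.le hσ1 (by positivity)
    have hz : piP p / 2 * (lam / (p - 1)) ^ (1 / p) < piP p / 2 := by nlinarith
    obtain ⟨hy, hy1, hey⟩ := sinPHalf_spec p (piP p / 2 * (lam / (p - 1)) ^ (1 / p)) hp
      (by positivity) hz
    have hyp := Real.rpow_lt_one hy.le hy1 hp0
    have := final p lam 1 _ _ hp hk (by rw [kpow _ hσ]; field_simp) hy (by linarith)
      (by refine Eq.trans ?_ (hey.trans (mul_comm _ _)); simp only [arcsinP, one_mul]) ε hε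
    rw [kpow1 _ hσ] at this
    simpa only [lyapC, h, if_true, cotP, cosP, sinP, hz.le, one_mul] using this
end

section
/- Let 1 < p < ∞, 0 < λ < p − 1, K = (λ/(p−1))^{1/p}, and y ∈ (0,π_p/2]. Define u_y : [0,π_p] → ℝ by u_y(x) = sin_p(Kx)/sin_p(Ky) for x ∈ [0,y] and u_y(x) = sin_p(K(π_p−x))/sin_p(K(π_p−y)) for x ∈ [y,π_p]. Then for every function v : [0,π_p] → ℝ that is continuously differentiable on [0,π_p] with v(0) = v(π_p) = 0 and v(y) = 1, one has J(v) ≥ J(u_y), where J(w) = ∫₀^{π_p} |w′(x)|^p dx − λ∫₀^{π_p} |w(x)|^p dx (the integrals for u_y being taken piecewise on [0,y] and [y,π_p]). -/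
/-- The function `u_y(x) = sin_p (K x)/sin_p (K y)` on `[0, y]`,
`u_y(x) = sin_p (K (π_p - x))/sin_p (K (π_p - y))` on `[y, π_p]`. -/
noncomputable def uY (p K y x : ℝ) : ℝ :=
  if x ≤ y then sinP p (K * x) / sinP p (K * y)
  else sinP p (K * (piP p - x)) / sinP p (K * (piP p - y))

open Set MeasureTheory in
theorem sp_integrand_int (p : ℝ) (hp : 1 < p) :
    IntervalIntegrable (fun t : ℝ => (1 - t ^ p) ^ (-(1 / p))) volume 0 1 := by
  have h1 : IntervalIntegrable (fun t : ℝ => (1 - t) ^ (-(1 / p))) volume 0 1 := by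
    have h0 : IntervalIntegrable (fun t : ℝ => t ^ (-(1 / p))) volume 1 0 := by
      apply intervalIntegral.intervalIntegrable_rpow'
      have : 1 / p < 1 := by rw [div_lt_one (by linarith)]; exact hp
      linarith
    simpa using h0.comp_sub_left 1
  refine h1.mono_fun ?_ ?_
  · apply Measurable.aestronglyMeasurable
    fun_prop
  · rw [Filter.EventuallyLE, ae_restrict_iff' measurableSet_uIoc]
    have : ∀ᵐ x : ℝ ∂volume, x ≠ 1 := by
      rw [ae_iff]; simp
    filter_upwards [this] with x hx1 hx
    rw [uIoc_of_le zero_le_one] at hx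
    have hx' : x < 1 := lt_of_le_of_ne hx.2 hx1
    have hxp : x ^ p ≤ x := by
      have := Real.rpow_le_rpow_of_exponent_ge hx.1 hx.2 hp.le
      simpa using this
    rw [Real.norm_of_nonneg (Real.rpow_nonneg (by linarith) _),
      Real.norm_of_nonneg (Real.rpow_nonneg (by linarith) _)]
    apply Real.rpow_le_rpow_of_nonpos (by linarith) (by linarith)
    have : 0 < 1 / p := by positivity
    linarith

open Set MeasureTheory in
theorem sp_integrand_int' (p : ℝ) (hp : 1 < p) {a b : ℝ} (ha : a ∈ Icc (0:ℝ) 1)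
    (hb : b ∈ Icc (0:ℝ) 1) :
    IntervalIntegrable (fun t : ℝ => (1 - t ^ p) ^ (-(1 / p))) volume a b := by
  refine (sp_integrand_int p hp).mono_set ?_
  rw [uIcc_of_le (zero_le_one : (0:ℝ) ≤ 1)]
  exact uIcc_subset_Icc ha hb

open Set MeasureTheory in
theorem sp_arcsin_sub (p : ℝ) (hp : 1 < p) {a b : ℝ} (ha : a ∈ Icc (0:ℝ) 1)
    (hb : b ∈ Icc (0:ℝ) 1) (hab : a ≤ b) : b - a ≤ arcsinP p b - arcsinP p a := by
  have h0 : (0:ℝ) ∈ Icc (0:ℝ) 1 := by simp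
  unfold arcsinP
  rw [intervalIntegral.integral_interval_sub_left (sp_integrand_int' p hp h0 hb)
    (sp_integrand_int' p hp h0 ha)]
  have : b - a = ∫ t in a..b, (1:ℝ) := by simp
  rw [this]
  apply intervalIntegral.integral_mono_on_of_le_Ioo hab (by simp) (sp_integrand_int' p hp ha hb)
  intro x hx
  have hx0 : 0 < x := lt_of_le_of_lt ha.1 hx.1
  have hx1 : x < 1 := lt_of_lt_of_le hx.2 hb.2
  have h2 : x ^ p < 1 := Real.rpow_lt_one hx0.le hx1 (by linarith)
  have h3 : 0 < x ^ p := Real.rpow_pos_of_pos hx0 p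
  apply Real.one_le_rpow_of_pos_of_le_one_of_nonpos (by linarith) (by linarith)
  have : 0 < 1 / p := by positivity
  linarith

theorem sp_arcsin_zero (p : ℝ) : arcsinP p 0 = 0 := by simp [arcsinP]

theorem sp_pi_pos (p : ℝ) (hp : 1 < p) : 2 ≤ piP p := by
  have := sp_arcsin_sub p hp (a := 0) (b := 1) (by simp) (by simp) zero_le_one
  rw [sp_arcsin_zero] at this
  unfold piP
  linarith

open Set MeasureTheory in
theorem sp_arcsin_cont (p : ℝ) (hp : 1 < p) : ContinuousOn (arcsinP p) (Icc 0 1) := by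
  have := intervalIntegral.continuousOn_primitive_interval (a := (0:ℝ)) (b := 1) (μ := volume)
    (f := fun t : ℝ => (1 - t ^ p) ^ (-(1 / p))) (by
      rw [uIcc_of_le zero_le_one]
      exact (intervalIntegrable_iff_integrableOn_Icc_of_le zero_le_one).1 (sp_integrand_int p hp))
  rw [uIcc_of_le zero_le_one] at this
  exact this

open Set MeasureTheory in
theorem sp_arcsin_le (p : ℝ) (hp : 1 < p) {x : ℝ} (hx : x ∈ Icc (0:ℝ) 1) :
    arcsinP p x ≤ x * (piP p / 2) := by
  rcases eq_or_lt_of_le hx.1 with h | h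
  · rw [← h, sp_arcsin_zero]; simp
  · have h1 := intervalIntegral.integral_comp_mul_left (a := 0) (b := 1)
      (fun t : ℝ => (1 - t ^ p) ^ (-(1 / p))) h.ne'
    have h2 : arcsinP p x = x * ∫ t in (0:ℝ)..1, (1 - (x * t) ^ p) ^ (-(1 / p)) := by
      rw [h1]; simp only [smul_eq_mul, mul_zero, mul_one]
      rw [← mul_assoc, mul_inv_cancel₀ h.ne', one_mul]; rfl
    have h3 : piP p / 2 = ∫ t in (0:ℝ)..1, (1 - t ^ p) ^ (-(1 / p)) := by
      unfold piP arcsinP; ring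
    rw [h2, h3]
    apply mul_le_mul_of_nonneg_left _ hx.1
    apply intervalIntegral.integral_mono_on_of_le_Ioo zero_le_one _ (sp_integrand_int p hp)
    · intro t ht
      have h4 : x * t ≤ t := by nlinarith [hx.2, ht.1]
      have h5 : t ^ p < 1 := Real.rpow_lt_one ht.1.le ht.2 (by linarith)
      have h6 : (x * t) ^ p ≤ t ^ p :=
        Real.rpow_le_rpow (mul_nonneg hx.1 ht.1.le) h4 (by linarith)
      apply Real.rpow_le_rpow_of_nonpos (by linarith) (by linarith)
      have : 0 < 1 / p := by positivity
      linarith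
    · have := (sp_integrand_int' p hp (a := 0) (b := x) (by simp) hx).comp_mul_left (c := x)
      simpa [h.ne'] using this

open Set in
theorem sp_half_spec (p : ℝ) (hp : 1 < p) {t : ℝ} (ht : t ∈ Icc (0:ℝ) (piP p / 2)) :
    sinPHalf p t ∈ Icc (0:ℝ) 1 ∧ arcsinP p (sinPHalf p t) = t := by
  have h := intermediate_value_Icc (zero_le_one : (0:ℝ) ≤ 1) (sp_arcsin_cont p hp)
  rw [sp_arcsin_zero] at h
  have h1 : arcsinP p 1 = piP p / 2 := by unfold piP; ring
  rw [h1] at h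
  obtain ⟨a, ha, hat⟩ := h ht
  exact ⟨Function.invFunOn_mem ⟨a, ha, hat⟩, Function.invFunOn_eq ⟨a, ha, hat⟩⟩

open Set in
theorem sp_half_lip (p : ℝ) (hp : 1 < p) :
    LipschitzOnWith 1 (sinPHalf p) (Icc (0:ℝ) (piP p / 2)) := by
  apply LipschitzOnWith.of_le_add
  intro s hs t ht
  obtain ⟨h1, h2⟩ := sp_half_spec p hp hs
  obtain ⟨h3, h4⟩ := sp_half_spec p hp ht
  rcases le_total (sinPHalf p s) (sinPHalf p t) with h | h
  · have : 0 ≤ dist s t := dist_nonneg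
    linarith
  · have := sp_arcsin_sub p hp h3 h1 h
    rw [h2, h4] at this
    have h5 := le_abs_self (s - t)
    rw [Real.dist_eq]
    linarith

theorem sp_half_zero (p : ℝ) (hp : 1 < p) : sinPHalf p 0 = 0 := by
  have hpi := sp_pi_pos p hp
  obtain ⟨h1, h2⟩ := sp_half_spec p hp (t := 0) ⟨le_rfl, by linarith⟩
  have := sp_arcsin_sub p hp (a := 0) (b := sinPHalf p 0) (by simp) h1 h1.1
  rw [h2, sp_arcsin_zero] at this
  have := h1.1
  linarith

theorem sp_half_pi (p : ℝ) (hp : 1 < p) : sinPHalf p (piP p / 2) = 1 := by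
  have hpi := sp_pi_pos p hp
  obtain ⟨h1, h2⟩ := sp_half_spec p hp (t := piP p / 2) ⟨by linarith, by linarith⟩
  have := sp_arcsin_sub p hp (b := 1) (a := sinPHalf p (piP p / 2)) h1 (by simp) h1.2
  have h1' : arcsinP p 1 = piP p / 2 := by unfold piP; ring
  rw [h2, h1'] at this
  have := h1.2
  linarith

open Set in
theorem sp_half_ge (p : ℝ) (hp : 1 < p) {t : ℝ} (ht : t ∈ Icc (0:ℝ) (piP p / 2)) :
    t ≤ sinPHalf p t * (piP p / 2) := by
  obtain ⟨h1, h2⟩ := sp_half_spec p hp ht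
  have := sp_arcsin_le p hp h1
  rwa [h2] at this

open Set in
theorem sp_half_pos (p : ℝ) (hp : 1 < p) {t : ℝ} (ht : t ∈ Ioc (0:ℝ) (piP p / 2)) :
    0 < sinPHalf p t := by
  have hpi := sp_pi_pos p hp
  have := sp_half_ge p hp ⟨ht.1.le, ht.2⟩
  by_contra h
  push Not at h
  have := ht.1
  nlinarith

open Set in
theorem sp_half_lt (p : ℝ) (hp : 1 < p) {t : ℝ} (ht : t ∈ Ico (0:ℝ) (piP p / 2)) :
    sinPHalf p t < 1 := by
  obtain ⟨h1, h2⟩ := sp_half_spec p hp ⟨ht.1, ht.2.le⟩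
  refine lt_of_le_of_ne h1.2 fun h => ?_
  rw [h] at h2
  have h1' : arcsinP p 1 = piP p / 2 := by unfold piP; ring
  have := ht.2
  linarith

open Set MeasureTheory in
theorem sp_half_deriv (p : ℝ) (hp : 1 < p) {t : ℝ} (ht : t ∈ Ioo (0:ℝ) (piP p / 2)) :
    HasDerivAt (sinPHalf p) ((1 - sinPHalf p t ^ p) ^ (1 / p)) t := by
  have h0 := sp_half_pos p hp ⟨ht.1, ht.2.le⟩
  have h1 := sp_half_lt p hp ⟨ht.1.le, ht.2⟩
  have h2 : sinPHalf p t ^ p < 1 := Real.rpow_lt_one h0.le h1 (by linarith)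
  have hd : HasDerivAt (arcsinP p) ((1 - sinPHalf p t ^ p) ^ (-(1 / p))) (sinPHalf p t) := by
    refine intervalIntegral.integral_hasDerivAt_right
      (sp_integrand_int' p hp (by simp) ⟨h0.le, h1.le⟩) ?_ ?_
    · apply Measurable.stronglyMeasurable _ |>.stronglyMeasurableAtFilter
      fun_prop
    · apply ContinuousAt.rpow_const
      · apply ContinuousAt.sub continuousAt_const
        exact Real.continuousAt_rpow_const _ _ (Or.inl h0.ne')
      · left; linarith
  have hc : ContinuousAt (sinPHalf p) t :=
    (sp_half_lip p hp).continuousOn.continuousAt (Icc_mem_nhds ht.1 ht.2)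
  have := HasDerivAt.of_local_left_inverse hc hd
    (Real.rpow_pos_of_pos (by linarith) _).ne' (by
      filter_upwards [Icc_mem_nhds ht.1 ht.2] with s hs
      exact (sp_half_spec p hp hs).2)
  rwa [Real.rpow_neg (by linarith), inv_inv] at this

open Set Filter Topology in
theorem sp_ext {f g : ℝ → ℝ} {a b x : ℝ} (hx : x ∈ Ioo a b)
    (hd : ∀ y ∈ Ioo a b, y ≠ x → HasDerivAt f (g y) y) (hf : ContinuousAt f x)
    (hg : ContinuousAt g x) : HasDerivAt f (g x) x := by
  have A : HasDerivWithinAt f (g x) (Ici x) x := by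
    apply hasDerivWithinAt_Ici_of_tendsto_deriv (s := Ioo x b)
    · exact fun y hy => (hd y ⟨hx.1.trans hy.1, hy.2⟩
        hy.1.ne').differentiableAt.differentiableWithinAt
    · exact hf.continuousWithinAt
    · exact Ioo_mem_nhdsGT hx.2
    · have : Tendsto g (𝓝[>] x) (𝓝 (g x)) := tendsto_inf_left hg
      apply this.congr'
      filter_upwards [Ioo_mem_nhdsGT hx.2] with y hy
      exact (hd y ⟨hx.1.trans hy.1, hy.2⟩ hy.1.ne').deriv.symm
  have B : HasDerivWithinAt f (g x) (Iic x) x := by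
    apply hasDerivWithinAt_Iic_of_tendsto_deriv (s := Ioo a x)
    · exact fun y hy => (hd y ⟨hy.1, hy.2.trans hx.2⟩
        hy.2.ne).differentiableAt.differentiableWithinAt
    · exact hf.continuousWithinAt
    · exact Ioo_mem_nhdsLT hx.1
    · have : Tendsto g (𝓝[<] x) (𝓝 (g x)) := tendsto_inf_left hg
      apply this.congr'
      filter_upwards [Ioo_mem_nhdsLT hx.1] with y hy
      exact (hd y ⟨hy.1, hy.2.trans hx.2⟩ hy.2.ne).deriv.symm
  simpa using B.union A

theorem sp_sin_eq (p t : ℝ) : sinP p t = sinPHalf p (min t (piP p - t)) := by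
  unfold sinP
  split_ifs with h
  · rw [min_eq_left (by linarith)]
  · rw [min_eq_right (by linarith)]

open Set in
theorem sp_min_mem (p : ℝ) {t : ℝ} (ht : t ∈ Icc (0:ℝ) (piP p)) :
    min t (piP p - t) ∈ Icc (0:ℝ) (piP p / 2) := by
  constructor
  · exact le_min ht.1 (by linarith [ht.2])
  · rcases le_total t (piP p / 2) with h | h
    · exact (min_le_left _ _).trans h
    · exact (min_le_right _ _).trans (by linarith)

open Set in
theorem sp_sin_cont (p : ℝ) (hp : 1 < p) : ContinuousOn (sinP p) (Icc 0 (piP p)) := by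
  have h1 : sinP p = fun t => sinPHalf p (min t (piP p - t)) := by
    funext t; exact sp_sin_eq p t
  rw [h1]
  exact (sp_half_lip p hp).continuousOn.comp (by fun_prop) (fun t ht => sp_min_mem p ht)

open Set in
theorem sp_sin_mem (p : ℝ) (hp : 1 < p) {t : ℝ} (ht : t ∈ Icc (0:ℝ) (piP p)) :
    sinP p t ∈ Icc (0:ℝ) 1 := by
  rw [sp_sin_eq]; exact (sp_half_spec p hp (sp_min_mem p ht)).1

open Set in
theorem sp_sin_pos (p : ℝ) (hp : 1 < p) {t : ℝ} (ht : t ∈ Ioo (0:ℝ) (piP p)) :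
    0 < sinP p t := by
  rw [sp_sin_eq]
  refine sp_half_pos p hp ⟨lt_min ht.1 (by linarith [ht.2]), ?_⟩
  exact (sp_min_mem p (Ioo_subset_Icc_self ht)).2

open Set in
theorem sp_sin_lt (p : ℝ) (hp : 1 < p) {t : ℝ} (ht : t ∈ Ioo (0:ℝ) (piP p))
    (hne : t ≠ piP p / 2) : sinP p t < 1 := by
  rw [sp_sin_eq]
  refine sp_half_lt p hp ⟨(sp_min_mem p (Ioo_subset_Icc_self ht)).1, ?_⟩
  rcases lt_or_gt_of_ne hne with h | h
  · exact lt_of_le_of_lt (min_le_left _ _) h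
  · exact lt_of_le_of_lt (min_le_right _ _) (by linarith)

theorem sp_sin_zero (p : ℝ) (hp : 1 < p) : sinP p 0 = 0 := by
  have := sp_pi_pos p hp
  rw [sp_sin_eq, min_eq_left (by linarith), sp_half_zero p hp]

theorem sp_sin_pi (p : ℝ) (hp : 1 < p) : sinP p (piP p / 2) = 1 := by
  rw [sp_sin_eq, min_eq_left (by linarith), sp_half_pi p hp]

open Set in
theorem sp_if_cont {P : ℝ} (hP : 0 < P) {g : ℝ → ℝ} (hg : ContinuousOn g (Icc 0 P))
    (h0 : g (P / 2) = 0) :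
    ContinuousOn (fun t => if t ≤ P / 2 then g t else - g t) (Icc 0 P) := by
  have : (fun t => if t ≤ P / 2 then g t else - g t) =
      fun t => g (min t (P / 2)) - g (max t (P / 2)) := by
    funext t
    split_ifs with h
    · rw [min_eq_left h, max_eq_right h, h0, sub_zero]
    · rw [min_eq_right (by linarith), max_eq_left (by linarith), h0, zero_sub]
  rw [this]
  apply ContinuousOn.sub
  · exact hg.comp (by fun_prop) fun t ht => ⟨le_min ht.1 (by linarith), (min_le_left _ _).trans ht.2⟩
  · exact hg.comp (by fun_prop) fun t ht => ⟨ht.1.trans (le_max_left _ _), max_le ht.2 (by linarith)⟩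

/-- `|cos_p|^{p-1}` with the sign of `cos_p`. -/
noncomputable def spE (p t : ℝ) : ℝ :=
  if t ≤ piP p / 2 then (1 - sinP p t ^ p) ^ ((p - 1) / p)
  else -((1 - sinP p t ^ p) ^ ((p - 1) / p))

open Set in
theorem sp_aux_cont (p : ℝ) (hp : 1 < p) (r : ℝ) (hr : 0 < r) :
    ContinuousOn (fun t => if t ≤ piP p / 2 then (1 - sinP p t ^ p) ^ r
      else -((1 - sinP p t ^ p) ^ r)) (Icc 0 (piP p)) := by
  have := sp_pi_pos p hp
  apply sp_if_cont (by linarith)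
  · apply ContinuousOn.rpow_const
    · apply continuousOn_const.sub
      exact (sp_sin_cont p hp).rpow_const (fun _ _ => Or.inr (by linarith))
    · exact fun _ _ => Or.inr hr.le
  · rw [sp_sin_pi p hp]; simp [hr.ne']

open Set in
theorem sp_cos_cont (p : ℝ) (hp : 1 < p) : ContinuousOn (cosP p) (Icc 0 (piP p)) :=
  sp_aux_cont p hp (1 / p) (by positivity)

open Set in
theorem sp_E_cont (p : ℝ) (hp : 1 < p) : ContinuousOn (spE p) (Icc 0 (piP p)) :=
  sp_aux_cont p hp ((p - 1) / p) (div_pos (by linarith) (by linarith))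

open Set Filter Topology in
theorem sp_sin_deriv (p : ℝ) (hp : 1 < p) {t : ℝ} (ht : t ∈ Ioo (0:ℝ) (piP p)) :
    HasDerivAt (sinP p) (cosP p t) t := by
  have hpi := sp_pi_pos p hp
  have key : ∀ y ∈ Ioo (0:ℝ) (piP p), y ≠ piP p / 2 → HasDerivAt (sinP p) (cosP p y) y := by
    intro y hy hne
    rcases lt_or_gt_of_ne hne with h | h
    · have h1 := sp_half_deriv p hp ⟨hy.1, h⟩
      have h2 : cosP p y = (1 - sinPHalf p y ^ p) ^ (1 / p) := by
        simp [cosP, sinP, h.le]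
      rw [h2]
      apply h1.congr_of_eventuallyEq
      filter_upwards [Iio_mem_nhds h] with s hs
      simp [sinP, le_of_lt (mem_Iio.1 hs)]
    · have h1 := sp_half_deriv p hp (t := piP p - y) ⟨by linarith [hy.2], by linarith⟩
      have h2 : cosP p y = (1 - sinPHalf p (piP p - y) ^ p) ^ (1 / p) * (-1) := by
        simp [cosP, sinP, not_le.2 h]
      rw [h2]
      have h3 : HasDerivAt (fun s => piP p - s) (-1) y := by
        simpa using (hasDerivAt_id y).const_sub (piP p)
      apply (h1.comp y h3).congr_of_eventuallyEq
      filter_upwards [Ioi_mem_nhds h] with s hs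
      simp [sinP, not_le.2 (mem_Ioi.1 hs)]
  by_cases h : t = piP p / 2
  · rw [h] at ht ⊢
    apply sp_ext ht key
    · exact (sp_sin_cont p hp).continuousAt (Icc_mem_nhds ht.1 ht.2)
    · exact (sp_cos_cont p hp).continuousAt (Icc_mem_nhds ht.1 ht.2)
  · exact key t ht h

open Set Filter Topology in
theorem sp_E_deriv (p : ℝ) (hp : 1 < p) {t : ℝ} (ht : t ∈ Ioo (0:ℝ) (piP p)) :
    HasDerivAt (spE p) (-(p - 1) * sinP p t ^ (p - 1)) t := by
  have hpi := sp_pi_pos p hp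
  have key : ∀ y ∈ Ioo (0:ℝ) (piP p), y ≠ piP p / 2 →
      HasDerivAt (spE p) (-(p - 1) * sinP p y ^ (p - 1)) y := by
    intro y hy hne
    have hS0 := sp_sin_pos p hp hy
    have hS1 := sp_sin_lt p hp hy hne
    have hX : 0 < 1 - sinP p y ^ p := by
      have := Real.rpow_lt_one hS0.le hS1 (by linarith : 0 < p)
      linarith
    have hd := (((sp_sin_deriv p hp hy).rpow_const (p := p) (Or.inl hS0.ne')).const_sub
      1).rpow_const (p := (p - 1) / p) (Or.inl hX.ne')
    have he : (p - 1) / p - 1 = -(1 / p) := by field_simp; ring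
    rw [he, Real.rpow_neg hX.le] at hd
    have hX1 : 0 < (1 - sinP p y ^ p) ^ (1 / p) := Real.rpow_pos_of_pos hX _
    rcases lt_or_gt_of_ne hne with h | h
    · have hc : cosP p y = (1 - sinP p y ^ p) ^ (1 / p) := by simp [cosP, h.le]
      rw [hc] at hd
      have hd2 : HasDerivAt (fun s => (1 - sinP p s ^ p) ^ ((p - 1) / p))
          (-(p - 1) * sinP p y ^ (p - 1)) y := by
        refine hd.congr_deriv ?_
        have : p ≠ 0 := by linarith
        field_simp
      apply hd2.congr_of_eventuallyEq
      filter_upwards [Iio_mem_nhds h] with s hs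
      simp [spE, le_of_lt (mem_Iio.1 hs)]
    · have hc : cosP p y = - (1 - sinP p y ^ p) ^ (1 / p) := by simp [cosP, not_le.2 h]
      rw [hc] at hd
      have hd2 : HasDerivAt (fun s => -(1 - sinP p s ^ p) ^ ((p - 1) / p))
          (-(p - 1) * sinP p y ^ (p - 1)) y := by
        refine hd.neg.congr_deriv ?_
        have : p ≠ 0 := by linarith
        field_simp
      apply hd2.congr_of_eventuallyEq
      filter_upwards [Ioi_mem_nhds h] with s hs
      simp [spE, not_le.2 (mem_Ioi.1 hs)]
  by_cases h : t = piP p / 2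
  · rw [h] at ht ⊢
    apply sp_ext (g := fun t => -(p - 1) * sinP p t ^ (p - 1)) ht key
    · exact (sp_E_cont p hp).continuousAt (Icc_mem_nhds ht.1 ht.2)
    · apply ContinuousAt.mul continuousAt_const
      exact ((sp_sin_cont p hp).continuousAt (Icc_mem_nhds ht.1 ht.2)).rpow_const
        (Or.inr (by linarith))
  · exact key t ht h

open Set in
theorem sp_X_nonneg (p : ℝ) (hp : 1 < p) {t : ℝ} (ht : t ∈ Icc (0:ℝ) (piP p)) :
    0 ≤ 1 - sinP p t ^ p := by
  obtain ⟨h0, h1⟩ := sp_sin_mem p hp ht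
  have := Real.rpow_le_one h0 h1 (by linarith : 0 ≤ p)
  linarith

open Set in
theorem sp_E_cos (p : ℝ) (hp : 1 < p) {t : ℝ} (ht : t ∈ Icc (0:ℝ) (piP p)) :
    spE p t * cosP p t = 1 - sinP p t ^ p := by
  have hX := sp_X_nonneg p hp ht
  have h1 : (1 - sinP p t ^ p) ^ ((p - 1) / p) * (1 - sinP p t ^ p) ^ (1 / p)
      = 1 - sinP p t ^ p := by
    have e : (p - 1) / p + 1 / p = 1 := by
      have : p ≠ 0 := by linarith
      field_simp; ring
    rw [← Real.rpow_add' hX (by rw [e]; norm_num), e, Real.rpow_one]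
  unfold spE cosP
  split_ifs
  · exact h1
  · rw [neg_mul_neg]; exact h1

open Set in
theorem sp_abs_cos (p : ℝ) (hp : 1 < p) {t : ℝ} (ht : t ∈ Icc (0:ℝ) (piP p)) :
    |cosP p t| ^ p = 1 - sinP p t ^ p := by
  have hX := sp_X_nonneg p hp ht
  have h1 : |cosP p t| = (1 - sinP p t ^ p) ^ (1 / p) := by
    unfold cosP
    split_ifs
    · exact abs_of_nonneg (Real.rpow_nonneg hX _)
    · rw [abs_neg]; exact abs_of_nonneg (Real.rpow_nonneg hX _)
  rw [h1, ← Real.rpow_mul hX, one_div_mul_cancel (by linarith), Real.rpow_one]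

open Set in
theorem sp_abs_E' (p : ℝ) (hp : 1 < p) {t : ℝ} (ht : t ∈ Icc (0:ℝ) (piP p)) :
    |spE p t| = (1 - sinP p t ^ p) ^ ((p - 1) / p) := by
  have hX := sp_X_nonneg p hp ht
  unfold spE
  split_ifs
  · exact abs_of_nonneg (Real.rpow_nonneg hX _)
  · rw [abs_neg]; exact abs_of_nonneg (Real.rpow_nonneg hX _)

open Set in
theorem sp_abs_E (p : ℝ) (hp : 1 < p) {t : ℝ} (ht : t ∈ Icc (0:ℝ) (piP p)) :
    |spE p t| ^ (p / (p - 1)) = 1 - sinP p t ^ p := by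
  have hX := sp_X_nonneg p hp ht
  have e : (p - 1) / p * (p / (p - 1)) = 1 := by
    have : p ≠ 0 := by linarith
    have : p - 1 ≠ 0 := by linarith
    field_simp
  rw [sp_abs_E' p hp ht, ← Real.rpow_mul hX, e, Real.rpow_one]

open Set in
theorem sp_abs_E_le (p : ℝ) (hp : 1 < p) {t : ℝ} (ht : t ∈ Icc (0:ℝ) (piP p)) :
    |spE p t| ≤ 1 := by
  have hX := sp_X_nonneg p hp ht
  rw [sp_abs_E' p hp ht]
  apply Real.rpow_le_one hX
  · have := Real.rpow_nonneg (sp_sin_mem p hp ht).1 p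
    linarith
  · exact div_nonneg (by linarith) (by linarith)

open Set in
theorem sp_W_abs (p : ℝ) (hp : 1 < p) {t : ℝ} (ht : t ∈ Ioo (0:ℝ) (piP p)) :
    |spE p t / sinP p t ^ (p - 1)| ^ (p / (p - 1)) = (1 - sinP p t ^ p) / sinP p t ^ p := by
  have hS0 := sp_sin_pos p hp ht
  have h1 : 0 < sinP p t ^ (p - 1) := Real.rpow_pos_of_pos hS0 _
  rw [abs_div, abs_of_pos h1, Real.div_rpow (abs_nonneg _) h1.le,
    sp_abs_E p hp (Ioo_subset_Icc_self ht), ← Real.rpow_mul hS0.le,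
    mul_div_cancel₀ _ (by linarith : p - 1 ≠ 0)]

open Set in
theorem sp_W_deriv (p : ℝ) (hp : 1 < p) {t : ℝ} (ht : t ∈ Ioo (0:ℝ) (piP p)) :
    HasDerivAt (fun s => spE p s / sinP p s ^ (p - 1))
      (-(p - 1) * (1 + |spE p t / sinP p t ^ (p - 1)| ^ (p / (p - 1)))) t := by
  have hS0 := sp_sin_pos p hp ht
  have h1 : 0 < sinP p t ^ (p - 1) := Real.rpow_pos_of_pos hS0 _
  have hZ : 0 < sinP p t ^ p := Real.rpow_pos_of_pos hS0 _
  have hd := (sp_E_deriv p hp ht).div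
    ((sp_sin_deriv p hp ht).rpow_const (p := p - 1) (Or.inl hS0.ne')) h1.ne'
  refine hd.congr_deriv ?_
  rw [sp_W_abs p hp ht]
  have hEC := sp_E_cos p hp (Ioo_subset_Icc_self ht)
  have e1 : sinP p t ^ (p - 1) = sinP p t ^ p / sinP p t := by
    rw [Real.rpow_sub hS0, Real.rpow_one]
  have e2 : sinP p t ^ (p - 1 - 1) = sinP p t ^ p / sinP p t / sinP p t := by
    rw [Real.rpow_sub hS0, Real.rpow_one, e1]
  rw [e2, e1, ← hEC]
  generalize sinP p t ^ p = Z at *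
  generalize sinP p t = S at *
  field_simp
  ring_nf

open Set MeasureTheory in
theorem sp_lemB (p K L : ℝ) (hp : 1 < p) (hK : 0 < K) (hL : 0 < L) (hKL : K * L < piP p) :
    ∫ x in (0:ℝ)..L, (K * ((1 - sinP p (K * x) ^ p) - (p - 1) * sinP p (K * x) ^ p))
      = sinP p (K * L) * spE p (K * L) := by
  have hmaps : MapsTo (fun x => K * x) (Icc 0 L) (Icc 0 (piP p)) := fun x hx =>
    ⟨mul_nonneg hK.le hx.1, (mul_le_mul_of_nonneg_left hx.2 hK.le).trans hKL.le⟩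
  have hSc : ContinuousOn (fun x => sinP p (K * x)) (Icc 0 L) :=
    (sp_sin_cont p hp).comp (by fun_prop) hmaps
  have hEc : ContinuousOn (fun x => spE p (K * x)) (Icc 0 L) :=
    (sp_E_cont p hp).comp (by fun_prop) hmaps
  have hSp : ContinuousOn (fun x => sinP p (K * x) ^ p) (Icc 0 L) :=
    hSc.rpow_const (fun _ _ => Or.inr (by linarith))
  have := intervalIntegral.integral_eq_sub_of_hasDerivAt_of_le (a := 0) (b := L)
    (f := fun x => sinP p (K * x) * spE p (K * x))
    (f' := fun x => K * ((1 - sinP p (K * x) ^ p) - (p - 1) * sinP p (K * x) ^ p)) hL.le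
    (hSc.mul hEc) ?_ ?_
  · rw [this]; simp [sp_sin_zero p hp]
  · intro x hx
    have ht : K * x ∈ Ioo (0:ℝ) (piP p) :=
      ⟨mul_pos hK hx.1, (mul_lt_mul_of_pos_left hx.2 hK).trans hKL⟩
    have hm : HasDerivAt (fun x => K * x) K x := by
      simpa using (hasDerivAt_id x).const_mul K
    have h1 := (sp_sin_deriv p hp ht).comp x hm
    have h2 := (sp_E_deriv p hp ht).comp x hm
    refine (h1.mul h2).congr_deriv ?_
    have hEC := sp_E_cos p hp (Ioo_subset_Icc_self ht)
    have hS0 := sp_sin_pos p hp ht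
    have e1 : sinP p (K * x) ^ (p - 1) * sinP p (K * x) = sinP p (K * x) ^ p := by
      rw [Real.rpow_sub hS0, Real.rpow_one, div_mul_cancel₀ _ hS0.ne']
    simp only [Function.comp]
    rw [← hEC, ← e1]
    ring
  · apply ContinuousOn.intervalIntegrable
    rw [uIcc_of_le hL.le]
    fun_prop

open Set MeasureTheory in
theorem sp_lemU (p K L : ℝ) (hp : 1 < p) (hK : 0 < K) (hL : 0 < L) (hKL : K * L < piP p) :
    (∫ x in (0:ℝ)..L, (K / sinP p (K * L)) ^ p * (1 - sinP p (K * x) ^ p)) -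
      ((p - 1) * K ^ p) * (∫ x in (0:ℝ)..L, |sinP p (K * x) / sinP p (K * L)| ^ p)
      = K ^ (p - 1) * (spE p (K * L) / sinP p (K * L) ^ (p - 1)) := by
  have hmaps : MapsTo (fun x => K * x) (Icc 0 L) (Icc 0 (piP p)) := fun x hx =>
    ⟨mul_nonneg hK.le hx.1, (mul_le_mul_of_nonneg_left hx.2 hK.le).trans hKL.le⟩
  have hSc : ContinuousOn (fun x => sinP p (K * x)) (Icc 0 L) :=
    (sp_sin_cont p hp).comp (by fun_prop) hmaps
  have hSp : ContinuousOn (fun x => sinP p (K * x) ^ p) (Icc 0 L) :=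
    hSc.rpow_const (fun _ _ => Or.inr (by linarith))
  have hs : 0 < sinP p (K * L) := sp_sin_pos p hp ⟨mul_pos hK hL, hKL⟩
  have hB := sp_lemB p K L hp hK hL hKL
  have hi1 : IntervalIntegrable (fun x => 1 - sinP p (K * x) ^ p) volume 0 L := by
    apply ContinuousOn.intervalIntegrable
    rw [uIcc_of_le hL.le]; fun_prop
  have hi2 : IntervalIntegrable (fun x => (p - 1) * sinP p (K * x) ^ p) volume 0 L := by
    apply ContinuousOn.intervalIntegrable
    rw [uIcc_of_le hL.le]; fun_prop
  rw [intervalIntegral.integral_const_mul, intervalIntegral.integral_sub hi1 hi2,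
    intervalIntegral.integral_const_mul] at hB
  have h2 : (∫ x in (0:ℝ)..L, |sinP p (K * x) / sinP p (K * L)| ^ p) =
      ∫ x in (0:ℝ)..L, (sinP p (K * L) ^ p)⁻¹ * sinP p (K * x) ^ p := by
    apply intervalIntegral.integral_congr
    intro x hx
    rw [uIcc_of_le hL.le] at hx
    have h0 := (sp_sin_mem p hp (hmaps hx)).1
    simp only
    rw [abs_of_nonneg (div_nonneg h0 hs.le), Real.div_rpow h0 hs.le]
    ring
  rw [h2, intervalIntegral.integral_const_mul, intervalIntegral.integral_const_mul,
    Real.div_rpow hK.le hs.le, Real.rpow_sub hK, Real.rpow_sub hs, Real.rpow_one, Real.rpow_one]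
  have hsp : 0 < sinP p (K * L) ^ p := Real.rpow_pos_of_pos hs _
  generalize (∫ x in (0:ℝ)..L, (1 - sinP p (K * x) ^ p)) = I1 at *
  generalize (∫ x in (0:ℝ)..L, (sinP p (K * x) ^ p)) = I2 at *
  generalize sinP p (K * L) ^ p = Z at *
  generalize K ^ p = Kp at *
  field_simp
  linear_combination Kp * hB

open Set MeasureTheory Filter Topology in
theorem sp_lemA (p K L : ℝ) (hp : 1 < p) (hK : 0 < K) (hL : 0 < L) (hKL : K * L < piP p)
    (v v' : ℝ → ℝ) (hv' : ContinuousOn v' (Icc 0 L))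
    (hd : ∀ x ∈ Icc (0:ℝ) L, HasDerivWithinAt v (v' x) (Icc 0 L) x)
    (hv0 : v 0 = 0) (hv1 : v L = 1) :
    K ^ (p - 1) * (spE p (K * L) / sinP p (K * L) ^ (p - 1)) ≤
      (∫ x in (0:ℝ)..L, |v' x| ^ p) - ((p - 1) * K ^ p) * ∫ x in (0:ℝ)..L, |v x| ^ p := by
  have hpi := sp_pi_pos p hp
  have hmaps : MapsTo (fun x => K * x) (Icc 0 L) (Icc 0 (piP p)) := fun x hx =>
    ⟨mul_nonneg hK.le hx.1, (mul_le_mul_of_nonneg_left hx.2 hK.le).trans hKL.le⟩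
  have hSc : ContinuousOn (fun x => sinP p (K * x)) (Icc 0 L) :=
    (sp_sin_cont p hp).comp (by fun_prop) hmaps
  have hEc : ContinuousOn (fun x => spE p (K * x)) (Icc 0 L) :=
    (sp_E_cont p hp).comp (by fun_prop) hmaps
  have hvc : ContinuousOn v (Icc 0 L) := fun x hx => (hd x hx).continuousWithinAt
  have hvp : ContinuousOn (fun x => |v x| ^ p) (Icc 0 L) :=
    hvc.abs.rpow_const (fun _ _ => Or.inr (by linarith))
  have hvp' : ContinuousOn (fun x => |v' x| ^ p) (Icc 0 L) :=
    hv'.abs.rpow_const (fun _ _ => Or.inr (by linarith))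
  have hi1 : IntervalIntegrable (fun x => |v' x| ^ p) volume 0 L := by
    apply ContinuousOn.intervalIntegrable
    rw [uIcc_of_le hL.le]; exact hvp'
  have hi2 : IntervalIntegrable (fun x => ((p - 1) * K ^ p) * |v x| ^ p) volume 0 L := by
    apply ContinuousOn.intervalIntegrable
    rw [uIcc_of_le hL.le]; fun_prop
  set W : ℝ → ℝ := fun s => spE p s / sinP p s ^ (p - 1) with hW
  have hpos : ∀ x ∈ Ioc (0:ℝ) L, K * x ∈ Ioo (0:ℝ) (piP p) := fun x hx =>
    ⟨mul_pos hK hx.1, lt_of_le_of_lt (mul_le_mul_of_nonneg_left hx.2 hK.le) hKL⟩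
  obtain ⟨M, hM⟩ : ∃ M : ℝ, ∀ x ∈ Icc (0:ℝ) L, ‖v' x‖ ≤ M :=
    isCompact_Icc.exists_bound_of_continuousOn hv'
  have hlip : ∀ x ∈ Icc (0:ℝ) L, |v x| ≤ M * x := by
    intro x hx
    have := (convex_Icc (0:ℝ) L).norm_image_sub_le_of_norm_hasDerivWithin_le hd hM
      (left_mem_Icc.2 hL.le) hx
    simpa [hv0, abs_of_nonneg hx.1] using this
  have hM0 : 0 ≤ M := (norm_nonneg _).trans (hM 0 (left_mem_Icc.2 hL.le))
  have hGc : ContinuousOn (fun x => |v x| ^ p * (K ^ (p - 1) * W (K * x))) (Icc 0 L) := by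
    intro x hx
    rcases eq_or_lt_of_le hx.1 with h | h
    · subst h
      have h0 : |v 0| ^ p * (K ^ (p - 1) * W (K * 0)) = 0 := by
        rw [hv0, abs_zero, Real.zero_rpow (by linarith), zero_mul]
      unfold ContinuousWithinAt
      beta_reduce
      rw [h0]
      have hb : Tendsto (fun x => |v x| * (M * (piP p / 2)) ^ (p - 1)) (𝓝[Icc 0 L] 0) (𝓝 0) := by
        have : Tendsto (fun x => |v x| * (M * (piP p / 2)) ^ (p - 1)) (𝓝[Icc 0 L] 0)
            (𝓝 (|v 0| * (M * (piP p / 2)) ^ (p - 1))) :=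
          ((hvc 0 hx).abs).mul_const _
        simpa [hv0] using this
      refine squeeze_zero_norm' ?_ hb
      have hnear : ∀ᶠ x in 𝓝[Icc 0 L] (0:ℝ), x < piP p / 2 / K :=
        mem_nhdsWithin_of_mem_nhds (Iio_mem_nhds (by positivity))
      filter_upwards [hnear, self_mem_nhdsWithin] with x hx1 hx2
      rw [lt_div_iff₀ hK] at hx1
      rcases eq_or_lt_of_le hx2.1 with h | h
      · rw [← h, h0]; simp [hv0]
      · have hp1 := hpos x ⟨h, hx2.2⟩
        have hS0 := sp_sin_pos p hp hp1
        have hSge : K * x ≤ sinP p (K * x) * (piP p / 2) := by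
          have := sp_half_ge p hp (t := K * x) ⟨hp1.1.le, by linarith⟩
          have e : sinP p (K * x) = sinPHalf p (K * x) := by
            unfold sinP; rw [if_pos (by linarith)]
          rwa [e]
        have hE := sp_abs_E_le p hp (hmaps hx2)
        have hl := hlip x hx2
        have hS1 : 0 < sinP p (K * x) ^ (p - 1) := Real.rpow_pos_of_pos hS0 _
        have h3 : K * |v x| / sinP p (K * x) ≤ M * (piP p / 2) := by
          rw [div_le_iff₀ hS0]
          calc K * |v x| ≤ K * (M * x) := by gcongr
            _ = M * (K * x) := by ring
            _ ≤ M * (sinP p (K * x) * (piP p / 2)) := by gcongr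
            _ = _ := by ring
        have h4 : (K * |v x| / sinP p (K * x)) ^ (p - 1) ≤ (M * (piP p / 2)) ^ (p - 1) :=
          Real.rpow_le_rpow (by positivity) h3 (by linarith)
        have e1 : |v x| ^ p = |v x| * |v x| ^ (p - 1) := by
          rw [← Real.rpow_one_add' (abs_nonneg _) (by linarith)]
          congr 1; ring
        have e2 : (K * |v x| / sinP p (K * x)) ^ (p - 1) =
            K ^ (p - 1) * |v x| ^ (p - 1) / sinP p (K * x) ^ (p - 1) := by
          rw [Real.div_rpow (by positivity) hS0.le, Real.mul_rpow hK.le (abs_nonneg _)]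
        have hKp : 0 < K ^ (p - 1) := Real.rpow_pos_of_pos hK _
        have hvn : 0 ≤ |v x| ^ (p - 1) := Real.rpow_nonneg (abs_nonneg _) _
        calc ‖|v x| ^ p * (K ^ (p - 1) * W (K * x))‖
            = |v x| * (K ^ (p - 1) * |v x| ^ (p - 1) / sinP p (K * x) ^ (p - 1)) *
              |spE p (K * x)| := by
              rw [hW, Real.norm_eq_abs, abs_mul, abs_mul, abs_div, abs_of_pos hKp,
                abs_of_pos hS1, e1, abs_of_nonneg (mul_nonneg (abs_nonneg _) hvn)]
              ring
          _ ≤ |v x| * (K ^ (p - 1) * |v x| ^ (p - 1) / sinP p (K * x) ^ (p - 1)) * 1 := by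
              gcongr
          _ ≤ |v x| * (M * (piP p / 2)) ^ (p - 1) := by
              rw [mul_one, ← e2]; gcongr
    · have hp1 := hpos x ⟨h, hx.2⟩
      have hS0 := sp_sin_pos p hp hp1
      refine (hvp x hx).mul (continuousWithinAt_const.mul ((hEc x hx).div ?_ ?_))
      · exact (hSc x hx).rpow_const (Or.inl hS0.ne')
      · exact (Real.rpow_pos_of_pos hS0 _).ne'
  have hmain := intervalIntegral.sub_le_integral_of_hasDeriv_right_of_le (a := 0) (b := L)
    (g := fun x => |v x| ^ p * (K ^ (p - 1) * W (K * x)))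
    (g' := fun x => (p * |v x| ^ (p - 2) * v x * v' x) * (K ^ (p - 1) * W (K * x)) +
      |v x| ^ p * (K ^ (p - 1) * ((-(p - 1) * (1 + |W (K * x)| ^ (p / (p - 1)))) * K)))
    (φ := fun x => |v' x| ^ p - ((p - 1) * K ^ p) * |v x| ^ p) hL.le hGc ?_ ?_ ?_
  · rw [intervalIntegral.integral_sub hi1 hi2, intervalIntegral.integral_const_mul] at hmain
    simp only [hv0, hv1, abs_zero, abs_one, Real.one_rpow, one_mul] at hmain
    rw [Real.zero_rpow (by linarith), zero_mul, sub_zero] at hmain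
    exact hmain
  · intro x hx
    have hdx : HasDerivAt v (v' x) x :=
      (hd x (Ioo_subset_Icc_self hx)).hasDerivAt (Icc_mem_nhds hx.1 hx.2)
    have h1 := (hasDerivAt_abs_rpow (v x) hp).comp x hdx
    have hm : HasDerivAt (fun x => K * x) K x := by
      simpa using (hasDerivAt_id x).const_mul K
    have h2 := ((sp_W_deriv p hp (hpos x ⟨hx.1, hx.2.le⟩)).comp x hm).const_mul (K ^ (p - 1))
    exact (h1.mul h2).hasDerivWithinAt
  · exact (intervalIntegrable_iff_integrableOn_Icc_of_le hL.le).1 (hi1.sub hi2)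
  · intro x hx
    have hp0 : p ≠ 0 := by linarith
    have hp10 : p - 1 ≠ 0 := by linarith
    have hq : p.HolderConjugate (p / (p - 1)) := Real.HolderConjugate.conjExponent hp
    have hKp : 0 < K ^ (p - 1) := Real.rpow_pos_of_pos hK _
    have hvn : 0 ≤ |v x| ^ (p - 1) := Real.rpow_nonneg (abs_nonneg _) _
    have hY := Real.young_inequality_of_nonneg (abs_nonneg (v' x))
      (b := K ^ (p - 1) * |W (K * x)| * |v x| ^ (p - 1)) (by positivity) hq
    have e1 : (K ^ (p - 1) * |W (K * x)| * |v x| ^ (p - 1)) ^ (p / (p - 1)) =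
        K ^ p * |W (K * x)| ^ (p / (p - 1)) * |v x| ^ p := by
      rw [Real.mul_rpow (by positivity) hvn, Real.mul_rpow hKp.le (abs_nonneg _),
        ← Real.rpow_mul hK.le, ← Real.rpow_mul (abs_nonneg _), mul_div_cancel₀ _ hp10]
    rw [e1] at hY
    have e2 : K ^ p = K ^ (p - 1) * K := by
      rw [Real.rpow_sub hK, Real.rpow_one, div_mul_cancel₀ _ hK.ne']
    have hY2 : p * (|v' x| * (K ^ (p - 1) * |W (K * x)| * |v x| ^ (p - 1))) ≤
        |v' x| ^ p + (p - 1) * (K ^ p * |W (K * x)| ^ (p / (p - 1)) * |v x| ^ p) := by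
      have h := mul_le_mul_of_nonneg_left hY (by linarith : 0 ≤ p)
      refine h.trans (le_of_eq ?_)
      field_simp
    have e3 : |(|v x| ^ (p - 2) * v x)| ≤ |v x| ^ (p - 1) := by
      rcases eq_or_ne (v x) 0 with h | h
      · rw [h]; simpa using Real.rpow_nonneg le_rfl (p - 1)
      · have h' : 0 < |v x| := abs_pos.2 h
        rw [abs_mul, abs_of_nonneg (Real.rpow_nonneg (abs_nonneg _) _),
          ← Real.rpow_add_one h'.ne']
        apply le_of_eq; congr 1; ring
    have e4 : (p * |v x| ^ (p - 2) * v x * v' x) * (K ^ (p - 1) * W (K * x)) ≤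
        p * (|v' x| * (K ^ (p - 1) * |W (K * x)| * |v x| ^ (p - 1))) := by
      calc (p * |v x| ^ (p - 2) * v x * v' x) * (K ^ (p - 1) * W (K * x))
          = p * ((|v x| ^ (p - 2) * v x) * v' x * (K ^ (p - 1) * W (K * x))) := by ring
        _ ≤ p * |(|v x| ^ (p - 2) * v x) * v' x * (K ^ (p - 1) * W (K * x))| := by
            gcongr; exact le_abs_self _
        _ = p * (|(|v x| ^ (p - 2) * v x)| * |v' x| * (K ^ (p - 1) * |W (K * x)|)) := by
            rw [abs_mul, abs_mul (_ * _) (v' x), abs_mul (K ^ (p - 1)), abs_of_pos hKp]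
        _ ≤ p * (|v x| ^ (p - 1) * |v' x| * (K ^ (p - 1) * |W (K * x)|)) := by
            gcongr
        _ = _ := by ring
    have := e4.trans hY2
    rw [e2] at this ⊢
    linarith


/-- For `0 < λ < p-1`, `K = (λ/(p-1))^(1/p)` and `y ∈ (0, π_p/2]`, the function `u_y`
minimizes `J(w) = ∫ |w'|^p - λ ∫ |w|^p` among continuously differentiable `v` on `[0, π_p]`
with `v(0) = v(π_p) = 0` and `v(y) = 1`. -/
theorem uY_minimizes (p lam K y : ℝ) (hp : 1 < p)
    (hlam0 : 0 < lam) (hlam1 : lam < p - 1)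
    (hK : K = (lam / (p - 1)) ^ (1 / p))
    (hy0 : 0 < y) (hy : y ≤ piP p / 2)
    (v v' : ℝ → ℝ)
    (hv' : ContinuousOn v' (Set.Icc 0 (piP p)))
    (hvderiv : ∀ x ∈ Set.Icc (0:ℝ) (piP p), HasDerivWithinAt v (v' x) (Set.Icc 0 (piP p)) x)
    (hv0 : v 0 = 0) (hvpi : v (piP p) = 0) (hvy : v y = 1) :
    (∫ x in (0:ℝ)..piP p, |v' x| ^ p) - lam * ∫ x in (0:ℝ)..piP p, |v x| ^ p ≥
      (∫ x in (0:ℝ)..piP p, |deriv (uY p K y) x| ^ p) -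
        lam * ∫ x in (0:ℝ)..piP p, |uY p K y x| ^ p := by
  have hpi := sp_pi_pos p hp
  have hp1 : 0 < p - 1 := by linarith
  have hr0 : 0 < lam / (p - 1) := div_pos hlam0 hp1
  have hr1 : lam / (p - 1) < 1 := (div_lt_one hp1).2 hlam1
  have hK0 : 0 < K := by rw [hK]; exact Real.rpow_pos_of_pos hr0 _
  have hK1 : K < 1 := by rw [hK]; exact Real.rpow_lt_one hr0.le hr1 (by positivity)
  have hKp : lam = (p - 1) * K ^ p := by
    rw [hK, ← Real.rpow_mul hr0.le, one_div_mul_cancel (by linarith), Real.rpow_one,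
      mul_div_cancel₀ _ hp1.ne']
  clear hK
  have hyp : y < piP p := by linarith
  set P := piP p with hP
  have hL2 : 0 < P - y := by linarith
  have hKL1 : K * y < P := by nlinarith
  have hKL2 : K * (P - y) < P := by nlinarith
  have hsub1 : Set.Icc 0 y ⊆ Set.Icc 0 P := Set.Icc_subset_Icc le_rfl hyp.le
  have hmap2 : Set.MapsTo (fun x => P - x) (Set.Icc 0 (P - y)) (Set.Icc 0 P) := fun x hx =>
    ⟨by linarith [hx.2], by linarith [hx.1]⟩
  -- the competitor
  have hA1 := sp_lemA p K y hp hK0 hy0 hKL1 v v' (hv'.mono hsub1)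
    (fun x hx => (hvderiv x (hsub1 hx)).mono hsub1) hv0 hvy
  have hA2 := sp_lemA p K (P - y) hp hK0 hL2 hKL2 (fun x => v (P - x)) (fun x => - v' (P - x))
    (hv'.comp (by fun_prop) hmap2).neg
    (fun x hx => by
      have h1 := hvderiv (P - x) (hmap2 hx)
      have h2 : HasDerivWithinAt (fun s => P - s) (-1) (Set.Icc 0 (P - y)) x := by
        simpa using ((hasDerivAt_id x).const_sub P).hasDerivWithinAt
      have h3 := h1.comp x h2 hmap2
      simpa [Function.comp_def] using h3)
    (by simp [hvpi]) (by simp [hvy])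
  simp only [abs_neg] at hA2
  rw [intervalIntegral.integral_comp_sub_left (fun x => |v' x| ^ p) P,
    intervalIntegral.integral_comp_sub_left (fun x => |v x| ^ p) P] at hA2
  simp only [sub_sub_cancel, sub_zero] at hA2
  have hvc : ContinuousOn v (Set.Icc 0 P) := fun x hx => (hvderiv x hx).continuousWithinAt
  have hint : ∀ f : ℝ → ℝ, ContinuousOn f (Set.Icc 0 P) →
      (∫ x in (0:ℝ)..P, |f x| ^ p) = (∫ x in (0:ℝ)..y, |f x| ^ p) + ∫ x in y..P, |f x| ^ p := by
    intro f hf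
    have hfp : ContinuousOn (fun x => |f x| ^ p) (Set.Icc 0 P) :=
      hf.abs.rpow_const (fun _ _ => Or.inr (by linarith))
    refine (intervalIntegral.integral_add_adjacent_intervals ?_ ?_).symm
    · apply ContinuousOn.intervalIntegrable
      rw [Set.uIcc_of_le hy0.le]; exact hfp.mono hsub1
    · apply ContinuousOn.intervalIntegrable
      rw [Set.uIcc_of_le hyp.le]; exact hfp.mono (Set.Icc_subset_Icc hy0.le le_rfl)
  -- the minimizer
  have hU1 := sp_lemU p K y hp hK0 hy0 hKL1
  have hU2 := sp_lemU p K (P - y) hp hK0 hL2 hKL2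
  have hs1 : 0 < sinP p (K * y) := sp_sin_pos p hp ⟨mul_pos hK0 hy0, hKL1⟩
  have hs2 : 0 < sinP p (K * (P - y)) := sp_sin_pos p hp ⟨mul_pos hK0 hL2, hKL2⟩
  have hm1 : Set.MapsTo (fun x => K * x) (Set.Icc 0 y) (Set.Icc 0 P) := fun x hx =>
    ⟨mul_nonneg hK0.le hx.1, (mul_le_mul_of_nonneg_left hx.2 hK0.le).trans hKL1.le⟩
  have hm2 : Set.MapsTo (fun x => K * (P - x)) (Set.Icc y P) (Set.Icc 0 P) := fun x hx =>
    ⟨mul_nonneg hK0.le (by linarith [hx.2]),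
      (mul_le_mul_of_nonneg_left (by linarith [hx.1]) hK0.le).trans hKL2.le⟩
  have hc1 : ContinuousOn (fun x => sinP p (K * x)) (Set.Icc 0 y) :=
    (sp_sin_cont p hp).comp (by fun_prop) hm1
  have hc2 : ContinuousOn (fun x => sinP p (K * (P - x))) (Set.Icc y P) :=
    (sp_sin_cont p hp).comp (by fun_prop) hm2
  have hcp1 : ContinuousOn (fun x => sinP p (K * x) ^ p) (Set.Icc 0 y) :=
    hc1.rpow_const (fun _ _ => Or.inr (by linarith))
  have hcp2 : ContinuousOn (fun x => sinP p (K * (P - x)) ^ p) (Set.Icc y P) :=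
    hc2.rpow_const (fun _ _ => Or.inr (by linarith))
  have hsplit : ∀ f f1 f2 : ℝ → ℝ, ContinuousOn f1 (Set.Icc 0 y) → ContinuousOn f2 (Set.Icc y P) →
      (∀ x ∈ Set.Ioo 0 y, f x = f1 x) → (∀ x ∈ Set.Ioo y P, f x = f2 x) →
      (∫ x in (0:ℝ)..P, f x) = (∫ x in (0:ℝ)..y, f1 x) + ∫ x in y..P, f2 x := by
    intro f f1 f2 h1 h2 e1 e2
    have i1 : IntervalIntegrable f1 MeasureTheory.volume 0 y := by
      apply ContinuousOn.intervalIntegrable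
      rwa [Set.uIcc_of_le hy0.le]
    have i2 : IntervalIntegrable f2 MeasureTheory.volume y P := by
      apply ContinuousOn.intervalIntegrable
      rwa [Set.uIcc_of_le hyp.le]
    have j1 : IntervalIntegrable f MeasureTheory.volume 0 y := by
      refine i1.congr_uIoo ?_
      rw [Set.uIoo_of_le hy0.le]
      exact fun x hx => (e1 x hx).symm
    have j2 : IntervalIntegrable f MeasureTheory.volume y P := by
      refine i2.congr_uIoo ?_
      rw [Set.uIoo_of_le hyp.le]
      exact fun x hx => (e2 x hx).symm
    rw [← intervalIntegral.integral_add_adjacent_intervals j1 j2]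
    congr 1
    · rw [intervalIntegral.integral_of_le hy0.le, intervalIntegral.integral_of_le hy0.le,
        MeasureTheory.integral_Ioc_eq_integral_Ioo, MeasureTheory.integral_Ioc_eq_integral_Ioo]
      exact MeasureTheory.setIntegral_congr_fun measurableSet_Ioo e1
    · rw [intervalIntegral.integral_of_le hyp.le, intervalIntegral.integral_of_le hyp.le,
        MeasureTheory.integral_Ioc_eq_integral_Ioo, MeasureTheory.integral_Ioc_eq_integral_Ioo]
      exact MeasureTheory.setIntegral_congr_fun measurableSet_Ioo e2
  have hu := hsplit (fun x => |uY p K y x| ^ p)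
    (fun x => |sinP p (K * x) / sinP p (K * y)| ^ p)
    (fun x => |sinP p (K * (P - x)) / sinP p (K * (P - y))| ^ p)
    ((hc1.div_const _).abs.rpow_const (fun _ _ => Or.inr (by linarith)))
    ((hc2.div_const _).abs.rpow_const (fun _ _ => Or.inr (by linarith)))
    (fun x hx => by simp only [uY, if_pos hx.2.le])
    (fun x hx => by simp only [uY, if_neg (not_le.2 hx.1), hP])
  have hdu := hsplit (fun x => |deriv (uY p K y) x| ^ p)
    (fun x => (K / sinP p (K * y)) ^ p * (1 - sinP p (K * x) ^ p))
    (fun x => (K / sinP p (K * (P - y))) ^ p * (1 - sinP p (K * (P - x)) ^ p))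
    (by fun_prop) (by fun_prop)
    (fun x hx => by
      have ht : K * x ∈ Set.Ioo (0:ℝ) (piP p) :=
        ⟨mul_pos hK0 hx.1, (mul_lt_mul_of_pos_left hx.2 hK0).trans hKL1⟩
      have hm : HasDerivAt (fun x => K * x) K x := by
        simpa using (hasDerivAt_id x).const_mul K
      have h1 := ((sp_sin_deriv p hp ht).comp x hm).div_const (sinP p (K * y))
      have h2 : HasDerivAt (uY p K y) (cosP p (K * x) * K / sinP p (K * y)) x := by
        apply h1.congr_of_eventuallyEq
        filter_upwards [Iio_mem_nhds hx.2] with s hs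
        simp [uY, le_of_lt (Set.mem_Iio.1 hs)]
      rw [h2.deriv, ← sp_abs_cos p hp (Set.Ioo_subset_Icc_self ht),
        ← Real.mul_rpow (by positivity) (abs_nonneg _)]
      congr 1
      rw [abs_div, abs_mul, abs_of_pos hK0, abs_of_pos hs1]
      ring)
    (fun x hx => by
      have ht : K * (P - x) ∈ Set.Ioo (0:ℝ) (piP p) :=
        ⟨mul_pos hK0 (by linarith [hx.2]),
          (mul_lt_mul_of_pos_left (by linarith [hx.1]) hK0).trans hKL2⟩
      have hm : HasDerivAt (fun x => K * (P - x)) (-K) x := by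
        simpa using ((hasDerivAt_id x).const_sub P).const_mul K
      have h1 := ((sp_sin_deriv p hp ht).comp x hm).div_const (sinP p (K * (P - y)))
      have h2 : HasDerivAt (uY p K y) (cosP p (K * (P - x)) * (-K) / sinP p (K * (P - y))) x := by
        apply h1.congr_of_eventuallyEq
        filter_upwards [Ioi_mem_nhds hx.1] with s hs
        simp [uY, not_le.2 (Set.mem_Ioi.1 hs), hP]
      rw [h2.deriv, ← sp_abs_cos p hp (Set.Ioo_subset_Icc_self ht),
        ← Real.mul_rpow (by positivity) (abs_nonneg _)]
      congr 1
      rw [abs_div, abs_mul, abs_neg, abs_of_pos hK0, abs_of_pos hs2]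
      ring)
  have r1 := intervalIntegral.integral_comp_sub_left (a := 0) (b := P - y)
    (fun x => (K / sinP p (K * (P - y))) ^ p * (1 - sinP p (K * (P - x)) ^ p)) P
  have r2 := intervalIntegral.integral_comp_sub_left (a := 0) (b := P - y)
    (fun x => |sinP p (K * (P - x)) / sinP p (K * (P - y))| ^ p) P
  simp only [sub_sub_cancel, sub_zero] at r1 r2
  rw [r1, r2] at hU2
  rw [hint v hvc, hint v' hv', hu, hdu, hKp]
  linarith
end
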